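/- arXiv:2305.10074 — 3 statements merged into one kernel-verified Lean document; each statement's English description precedes it below -/
import Mathlib

section
/- Fix n ≥ 1. Suppose p : Λ^{n+1}ℂ^{2n} → S_+ ⊗ S_− is a linear map that is Spin(Q)-equivariant and satisfies p(e_{{1},[n]}) = (−1)^{n(n−1)/2} · (1 ⊗ e_1). Then for all subsets I, I^∨ ⊆ [n] with #I + #I^∨ = n+1 and I ∩ I^∨ = {l}: if #I is even, then (−1)^{Σ_{j∈I^∨}(j−1)} p(e_{I,I^∨}) = σ(I) σ(I∖{l}) · e_I ⊗ e_{I∖{l}}, and if #I is odd, then (−1)^{Σ_{j∈I^∨}(j−1)} p(e_{I,I^∨}) = σ(I) σ(I∖{l}) · e_{I∖{l}} ⊗ e_I. -/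
open scoped TensorProduct

noncomputable section

/-- The model `ℂ^{2n} ≅ W ⊕ W^∨`, where `W = ℂ^n`. -/
abbrev V (n : ℕ) := (Fin n → ℂ) × (Fin n → ℂ)

/-- The basis vector `e_i ∈ W`. -/
def eW (n : ℕ) (i : Fin n) : V n := (Pi.single i 1, 0)

/-- The dual basis vector `e_i^∨ ∈ W^∨`. -/
def eD (n : ℕ) (i : Fin n) : V n := (0, Pi.single i 1)

/-- The symmetric bilinear form `Q((x,x∨),(y,y∨)) = ½ (x∨(y) + y∨(x))` on `W ⊕ W^∨`. -/
def Bform (n : ℕ) : V n →ₗ[ℂ] V n →ₗ[ℂ] ℂ :=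
  LinearMap.mk₂ ℂ (fun x y => (1 / 2) * (∑ i, x.2 i * y.1 i + ∑ i, y.2 i * x.1 i))
    (by intro x x' y; simp [add_mul, mul_add, Finset.sum_add_distrib]; ring)
    (by intro c x y; simp [Finset.mul_sum, mul_add]
        congr 1 <;> exact Finset.sum_congr rfl fun _ _ => by ring)
    (by intro x y y'; simp [add_mul, mul_add, Finset.sum_add_distrib]; ring)
    (by intro x y y'; simp [Finset.mul_sum, mul_add]
        congr 1 <;> exact Finset.sum_congr rfl fun _ _ => by ring)

/-- The quadratic form `x ↦ Q(x,x)` associated with `Q`. -/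
def Qq (n : ℕ) : QuadraticForm ℂ (V n) := LinearMap.BilinMap.toQuadraticMap (Bform n)

/-- The Clifford algebra `Cl(Q)` of `(ℂ^{2n}, Q)`. -/
abbrev Cl (n : ℕ) := CliffordAlgebra (Qq n)

/-- Conjugation `u ↦ u*` on the Clifford algebra, with `(x₁⋯x_r)* = (−1)^r x_r⋯x₁`. -/
def conjC {n : ℕ} (x : Cl n) : Cl n :=
  CliffordAlgebra.reverse (CliffordAlgebra.involute x)

/-- Membership in the Pin group of `Q`. -/
def PinG {n : ℕ} (x : Cl n) : Prop :=
  IsUnit x ∧ x * conjC x = 1 ∧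
    ∀ v : V n, ∃ v' : V n,
      CliffordAlgebra.involute x * CliffordAlgebra.ι (Qq n) v * conjC x =
        CliffordAlgebra.ι (Qq n) v'

/-- Membership in the Spin group of `Q`. -/
def SpinG {n : ℕ} (x : Cl n) : Prop :=
  PinG x ∧ x ∈ CliffordAlgebra.evenOdd (Qq n) 0

/-- The reflection `R_w(v) = v − 2 (Q(v,w)/Q(w,w)) w`. -/
def reflV (n : ℕ) (w : V n) : V n →ₗ[ℂ] V n :=
  LinearMap.id -
    (2 / Bform n w w) • ((LinearMap.toSpanSingleton ℂ (V n) w).comp ((Bform n).flip w))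

/-- The half-spin representation space `S = Λ^• W`. -/
abbrev SS (n : ℕ) := ExteriorAlgebra ℂ (Fin n → ℂ)

/-- The linear map sending `a ∈ ℂ^n` to the corresponding dual functional
`w ↦ Σ aᵢ wᵢ` (the identification of `W^∨` with the dual of `W`). -/
def dualL (n : ℕ) : (Fin n → ℂ) →ₗ[ℂ] Module.Dual ℂ (Fin n → ℂ) :=
  ∑ i : Fin n, LinearMap.smulRight (LinearMap.proj i) (LinearMap.proj i)

/-- The action of a vector `(a, a^∨) ∈ W ⊕ W^∨` on `S = Λ^• W`, by
`ω ↦ a ∧ ω + a^∨ ⌟ ω` (wedge plus interior product). -/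
def gamGen (n : ℕ) : V n →ₗ[ℂ] Module.End ℂ (SS n) :=
  (LinearMap.mul ℂ (SS n)).comp ((ExteriorAlgebra.ι ℂ).comp (LinearMap.fst ℂ _ _)) +
    (CliffordAlgebra.contractLeft (Q := (0 : QuadraticForm ℂ (Fin n → ℂ)))).comp
      ((dualL n).comp (LinearMap.snd ℂ _ _))

theorem gamGen_sq (n : ℕ) (x : V n) :
    gamGen n x * gamGen n x = algebraMap ℂ (Module.End ℂ (SS n)) (Qq n x) := by
  refine LinearMap.ext fun ω => ?_
  have key : ∀ (d : Module.Dual ℂ (Fin n → ℂ)) (a : Fin n → ℂ) (b : SS n),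
      CliffordAlgebra.contractLeft (Q := (0 : QuadraticForm ℂ (Fin n → ℂ))) d
        (ExteriorAlgebra.ι ℂ a * b) =
        d a • b - ExteriorAlgebra.ι ℂ a *
          CliffordAlgebra.contractLeft (Q := (0 : QuadraticForm ℂ (Fin n → ℂ))) d b :=
    fun d a b => CliffordAlgebra.contractLeft_ι_mul _ _ _
  simp only [Module.End.mul_apply, gamGen, LinearMap.add_apply, LinearMap.comp_apply,
    LinearMap.fst_apply, LinearMap.snd_apply, LinearMap.mul_apply']
  rw [mul_add, map_add, key]
  rw [CliffordAlgebra.contractLeft_contractLeft]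
  have hsq : ExteriorAlgebra.ι ℂ x.1 * (ExteriorAlgebra.ι ℂ x.1 * ω) = 0 := by
    rw [← mul_assoc, ExteriorAlgebra.ι_sq_zero, zero_mul]
  rw [hsq]

  have hd : dualL n x.2 x.1 = Qq n x := by
    have h1 : Qq n x = Bform n x x := rfl
    rw [h1]
    simp [dualL, Bform]
    ring
  rw [hd, Module.algebraMap_end_apply]
  abel

/-- The representation `Γ : Cl(Q) → End(S)` of the Clifford algebra on `S = Λ^• W`,
with a vector `(a, a^∨)` acting by wedging with `a` plus contraction by `a^∨`. -/
def Gamma (n : ℕ) : Cl n →ₐ[ℂ] Module.End ℂ (SS n) :=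
  CliffordAlgebra.lift (Qq n) ⟨gamGen n, gamGen_sq n⟩

/-- The wedge monomial `e_J = e_{j₁} ∧ ⋯ ∧ e_{j_k} ∈ Λ^• W` for `J = {j₁ < ⋯ < j_k}`. -/
def eS {n : ℕ} (J : Finset (Fin n)) : SS n :=
  ((J.sort (· ≤ ·)).map (fun i => ExteriorAlgebra.ι ℂ (Pi.single i 1))).prod

/-- The sign `σ(J)`: `−1` if `#J ≡ 2 (mod 4)` and `1` otherwise. -/
def sgn4 {n : ℕ} (J : Finset (Fin n)) : ℂ := if J.card % 4 = 2 then -1 else 1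

/-- The wedge monomial `e_{I,I^∨} = e_{i₁} ∧ ⋯ ∧ e_{i_k} ∧ e_{j₁}^∨ ∧ ⋯ ∧ e_{j_m}^∨`
as an element of the `(n+1)`-st exterior power `Λ^{n+1}(W ⊕ W^∨)` (for index sets with
`#I + #I^∨ = n + 1`). -/
def eII {n : ℕ} (I Id : Finset (Fin n)) : ↥(⋀[ℂ]^(n + 1) (V n)) :=
  ⟨ExteriorAlgebra.ιMulti ℂ (n + 1)
      (fun s => ((I.sort (· ≤ ·)).map (eW n) ++ (Id.sort (· ≤ ·)).map (eD n)).getD (s : ℕ) 0),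
    ExteriorAlgebra.ιMulti_range ℂ (n + 1) (Set.mem_range_self _)⟩

section SortedProducts

variable {A : Type*} [Ring A] {n : ℕ}

/-- The product of a family over a finite set of indices, in increasing order. -/
def sortProd (f : Fin n → A) (J : Finset (Fin n)) : A :=
  ((J.sort (· ≤ ·)).map f).prod

theorem sortProd_empty (f : Fin n → A) : sortProd f ∅ = 1 := by
  simp [sortProd]

theorem sortProd_singleton (f : Fin n → A) (i : Fin n) : sortProd f {i} = f i := by
  simp [sortProd]

theorem sortProd_insert_of_lt (f : Fin n → A) {J : Finset (Fin n)} {a : Fin n}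
    (h : ∀ b ∈ J, a < b) : sortProd f (insert a J) = f a * sortProd f J := by
  rw [sortProd, Finset.sort_insert (r := (· ≤ ·)) (fun b hb => (h b hb).le)
    (fun ha => lt_irrefl _ (h a ha))]
  simp [sortProd]

theorem sortProd_congr {f g : Fin n → A} {J : Finset (Fin n)} (h : ∀ j ∈ J, f j = g j) :
    sortProd f J = sortProd g J := by
  unfold sortProd
  congr 1
  exact List.map_congr_left fun j hj => h j ((Finset.mem_sort _).1 hj)

theorem map_sortProd {B F : Type*} [Ring B] [FunLike F A B] [MonoidHomClass F A B] (φ : F)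
    (f : Fin n → A) (J : Finset (Fin n)) :
    φ (sortProd f J) = sortProd (fun j => φ (f j)) J := by
  simp [sortProd, map_list_prod, Function.comp_def]

theorem mul_sortProd {f : Fin n → A} (hf : ∀ i j, f i * f j = -(f j * f i))
    (i : Fin n) (J : Finset (Fin n)) (hi : i ∉ J) :
    f i * sortProd f J = (-1) ^ (J.filter (· < i)).card * sortProd f (insert i J) := by
  induction J using Finset.induction_on_min with
  | empty => simp [sortProd]
  | insert a s h ih =>
    rw [Finset.mem_insert, not_or] at hi
    rcases lt_or_gt_of_ne hi.1 with hlt | hgt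
    · have hall : ∀ b ∈ insert a s, i < b := by
        intro b hb
        rcases Finset.mem_insert.1 hb with rfl | hb
        · exact hlt
        · exact hlt.trans (h b hb)
      rw [sortProd_insert_of_lt f hall, Finset.filter_eq_empty_iff.2
        (fun b hb => (hall b hb).le.not_gt)]
      simp
    · have hall : ∀ b ∈ insert i s, a < b := by
        intro b hb
        rcases Finset.mem_insert.1 hb with rfl | hb
        · exact hgt
        · exact h b hb
      rw [Finset.insert_comm, sortProd_insert_of_lt f hall, sortProd_insert_of_lt f h,
        ← mul_assoc, hf, Finset.filter_insert, if_pos hgt, Finset.card_insert_of_notMem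
        (fun ha => lt_irrefl _ (h a (Finset.mem_filter.1 ha).1)), neg_mul, mul_assoc, ih hi.2,
        ← mul_assoc, ← mul_assoc, ((Commute.neg_one_right (f a)).pow_right _).eq, pow_succ]
      simp

theorem sortProd_mul {f : Fin n → A} {x : A} (hx : ∀ j, f j * x = -(x * f j))
    (J : Finset (Fin n)) : sortProd f J * x = (-1) ^ J.card * (x * sortProd f J) := by
  induction J using Finset.induction_on_min with
  | empty => simp [sortProd]
  | insert a s h ih =>
    rw [sortProd_insert_of_lt f h, Finset.card_insert_of_notMem
      (fun ha => lt_irrefl _ (h a ha)), mul_assoc, ih, ← mul_assoc, ← mul_assoc,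
      ((Commute.neg_one_right (f a)).pow_right _).eq, mul_assoc _ (f a) x, hx, pow_succ]
    simp [mul_assoc]

theorem sortProd_insert {f : Fin n → A} (hf : ∀ i j, f i * f j = -(f j * f i))
    (i : Fin n) (J : Finset (Fin n)) (hi : i ∉ J) :
    sortProd f (insert i J) = (-1) ^ (J.filter (· < i)).card * (f i * sortProd f J) := by
  rw [mul_sortProd hf i J hi, ← mul_assoc, ← pow_add, (Even.add_self _).neg_one_pow, one_mul]

theorem mul_sortProd_of_mem {f : Fin n → A} (hf : ∀ i j, f i * f j = -(f j * f i))
    (hsq : ∀ i, f i * f i = 0) {i : Fin n} {J : Finset (Fin n)} (hi : i ∈ J) :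
    f i * sortProd f J = 0 := by
  rw [← Finset.insert_erase hi, sortProd_insert hf _ _ (Finset.notMem_erase i J), ← mul_assoc,
    ((Commute.neg_one_right (f i)).pow_right _).eq, mul_assoc, ← mul_assoc (f i), hsq]
  simp

theorem sortProd_mul_of_mem {f : Fin n → A} (hf : ∀ i j, f i * f j = -(f j * f i))
    (hsq : ∀ i, f i * f i = 0) {i : Fin n} {J : Finset (Fin n)} (hi : i ∈ J) :
    sortProd f J * f i = 0 := by
  rw [sortProd_mul (fun j => hf j i), mul_sortProd_of_mem hf hsq hi, mul_zero]

end SortedProducts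

section Transvections

variable {R M : Type*} [CommRing R] [AddCommGroup M] [Module R M] (Q : QuadraticForm R M)

/-- The Eichler transvection `v ↦ v + ⟨b, v⟩ a - ⟨a, v⟩ b`, where `⟨·,·⟩` is the polar form. -/
def transvec (a b : M) : M →ₗ[R] M :=
  LinearMap.id + (Q.polarBilin b).smulRight a - (Q.polarBilin a).smulRight b

theorem transvec_apply (a b v : M) :
    transvec Q a b v = v + QuadraticMap.polar Q b v • a - QuadraticMap.polar Q a v • b := rfl

theorem CliffordAlgebra.ι_mul_ι_swap (a b : M) :
    CliffordAlgebra.ι Q b * CliffordAlgebra.ι Q a =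
      algebraMap R _ (QuadraticMap.polar Q a b) -
        CliffordAlgebra.ι Q a * CliffordAlgebra.ι Q b := by
  rw [eq_sub_iff_add_eq', CliffordAlgebra.ι_mul_ι_add_swap]

theorem transvec_conj {a b : M} (ha : Q a = 0) (hb : Q b = 0)
    (hab : QuadraticMap.polar Q a b = 0) (v : M) :
    CliffordAlgebra.ι Q (transvec Q a b v) =
      (1 + CliffordAlgebra.ι Q a * CliffordAlgebra.ι Q b) * CliffordAlgebra.ι Q v *
        (1 - CliffordAlgebra.ι Q a * CliffordAlgebra.ι Q b) := by
  have h1 := CliffordAlgebra.ι_sq_scalar Q a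
  have h2 := CliffordAlgebra.ι_sq_scalar Q b
  have h3 := CliffordAlgebra.ι_mul_ι_swap Q a b
  have h4 := CliffordAlgebra.ι_mul_ι_swap Q a v
  have h5 := CliffordAlgebra.ι_mul_ι_swap Q b v
  rw [ha, map_zero] at h1
  rw [hb, map_zero] at h2
  rw [hab, map_zero, zero_sub] at h3
  rw [transvec_apply, map_sub, map_add, map_smul, map_smul]
  rw [Algebra.algebraMap_eq_smul_one] at h4 h5
  set x := CliffordAlgebra.ι Q a
  set y := CliffordAlgebra.ι Q b
  set z := CliffordAlgebra.ι Q v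
  have h6 : z * (x * y) = QuadraticMap.polar Q a v • y - QuadraticMap.polar Q b v • x
      + x * y * z := by
    rw [← mul_assoc, h4, sub_mul, mul_assoc x, h5, mul_sub]
    simp [mul_assoc]
    abel
  have h7 : x * y * z * (x * y) = 0 := by
    rw [mul_assoc, h6, mul_add, mul_sub, ← mul_assoc (x * y) (x * y)]
    simp only [mul_smul_comm]
    have e1 : x * y * y = 0 := by rw [mul_assoc, h2, mul_zero]
    have e2 : x * y * x = 0 := by rw [mul_assoc, h3, mul_neg, ← mul_assoc, h1, zero_mul, neg_zero]
    rw [e1, e2, ← mul_assoc (x * y) x, e2]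
    simp
  rw [mul_sub, mul_one, add_mul, add_mul, h7, one_mul, h6]
  abel

end Transvections

theorem conjC_one_add {n : ℕ} {a b : V n} (hab : QuadraticMap.polar (Qq n) a b = 0) :
    conjC (1 + CliffordAlgebra.ι (Qq n) a * CliffordAlgebra.ι (Qq n) b) =
      1 - CliffordAlgebra.ι (Qq n) a * CliffordAlgebra.ι (Qq n) b := by
  have h3 := CliffordAlgebra.ι_mul_ι_swap (Qq n) a b
  rw [hab, map_zero, zero_sub] at h3
  simp [conjC, h3, sub_eq_add_neg]

theorem spinG_one_add {n : ℕ} {a b : V n} (ha : Qq n a = 0) (hb : Qq n b = 0)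
    (hab : QuadraticMap.polar (Qq n) a b = 0) :
    SpinG (1 + CliffordAlgebra.ι (Qq n) a * CliffordAlgebra.ι (Qq n) b) := by
  have h1 := CliffordAlgebra.ι_sq_scalar (Qq n) a
  have h3 := CliffordAlgebra.ι_mul_ι_swap (Qq n) a b
  rw [ha, map_zero] at h1
  rw [hab, map_zero, zero_sub] at h3
  have hsq : CliffordAlgebra.ι (Qq n) a * CliffordAlgebra.ι (Qq n) b *
      (CliffordAlgebra.ι (Qq n) a * CliffordAlgebra.ι (Qq n) b) = 0 := by
    rw [← mul_assoc, mul_assoc _ _ (CliffordAlgebra.ι (Qq n) a), h3, mul_neg, ← mul_assoc, h1]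
    simp
  refine ⟨⟨?_, ?_, fun v => ⟨transvec (Qq n) a b v, ?_⟩⟩, ?_⟩
  · refine isUnit_iff_exists.2
      ⟨1 - CliffordAlgebra.ι (Qq n) a * CliffordAlgebra.ι (Qq n) b, ?_, ?_⟩
    · simp [add_mul, mul_sub, hsq]
    · simp [sub_mul, mul_add, hsq]
  · rw [conjC_one_add hab]
    simp [add_mul, mul_sub, hsq]
  · rw [conjC_one_add hab, transvec_conj _ ha hb hab]
    simp
  · exact Submodule.add_mem _ SetLike.GradedOne.one_mem
      (CliffordAlgebra.ι_mul_ι_mem_evenOdd_zero _ _ _)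

theorem ExteriorAlgebra.map_mem_exteriorPower {R M N : Type*} [CommRing R] [AddCommGroup M]
    [Module R M] [AddCommGroup N] [Module R N] (T : M →ₗ[R] N) (k : ℕ)
    {y : ExteriorAlgebra R M} (hy : y ∈ ⋀[R]^k M) : ExteriorAlgebra.map T y ∈ ⋀[R]^k N := by
  rw [← ExteriorAlgebra.ιMulti_span_fixedDegree] at hy
  induction hy using Submodule.span_induction with
  | mem x hx =>
    obtain ⟨v, rfl⟩ := hx
    rw [ExteriorAlgebra.map_apply_ιMulti]
    exact ExteriorAlgebra.ιMulti_range R k (Set.mem_range_self _)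
  | zero => simp
  | add x y _ _ hx hy => rw [map_add]; exact Submodule.add_mem _ hx hy
  | smul c x _ hx => rw [map_smul]; exact Submodule.smul_mem _ c hx

theorem Qq_apply {n : ℕ} (v : V n) : Qq n v = ∑ i, v.2 i * v.1 i := by
  change Bform n v v = _
  simp [Bform]
  ring

theorem polar_Qq {n : ℕ} (v w : V n) :
    QuadraticMap.polar (Qq n) v w = ∑ i, v.2 i * w.1 i + ∑ i, w.2 i * v.1 i := by
  simp only [QuadraticMap.polar, Qq_apply, Prod.fst_add, Prod.snd_add, Pi.add_apply,
    add_mul, mul_add, Finset.sum_add_distrib]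
  ring

theorem eII_coe {n : ℕ} {I Id : Finset (Fin n)} (h : I.card + Id.card = n + 1) :
    (eII I Id : ExteriorAlgebra ℂ (V n)) =
      sortProd (fun i => ExteriorAlgebra.ι ℂ (eW n i)) I *
        sortProd (fun i => ExteriorAlgebra.ι ℂ (eD n i)) Id := by
  have hL : (((I.sort (· ≤ ·)).map (eW n) ++ (Id.sort (· ≤ ·)).map (eD n))).length = n + 1 := by
    simp [h]
  simp only [eII, ExteriorAlgebra.ιMulti_apply]
  generalize hl : ((I.sort (· ≤ ·)).map (eW n) ++ (Id.sort (· ≤ ·)).map (eD n)) = L at hL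
  have : (List.ofFn fun s : Fin (n + 1) => ExteriorAlgebra.ι ℂ (L.getD (s : ℕ) 0)) =
      L.map (ExteriorAlgebra.ι ℂ) := by
    apply List.ext_getElem
    · simp [hL]
    · intro i h1 h2
      rw [List.length_map] at h2
      rw [List.getElem_ofFn, List.getElem_map, List.getD_eq_getElem _ _ h2]
  rw [this, ← hl]
  simp [sortProd, Function.comp_def]

theorem Gamma_eW {n : ℕ} (i : Fin n) (ω : SS n) :
    Gamma n (CliffordAlgebra.ι (Qq n) (eW n i)) ω = ExteriorAlgebra.ι ℂ (Pi.single i 1) * ω := by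
  simp [Gamma, gamGen, eW]

theorem Gamma_eD {n : ℕ} (i : Fin n) (ω : SS n) :
    Gamma n (CliffordAlgebra.ι (Qq n) (eD n i)) ω =
      CliffordAlgebra.contractLeft (Q := (0 : QuadraticForm ℂ (Fin n → ℂ)))
        (LinearMap.proj i) ω := by
  have : dualL n (Pi.single i 1) = LinearMap.proj i := by
    ext j
    simp [dualL, Pi.single_apply]
  simp [Gamma, gamGen, eD, this]

theorem neg_one_pow_mul_eq_smul {A : Type*} [Ring A] [Algebra ℂ A] (m : ℕ) (x : A) :
    (-1 : A) ^ m * x = ((-1 : ℂ) ^ m) • x := by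
  rcases Nat.even_or_odd m with h | h <;> simp [h.neg_one_pow]

section MonomialTransforms

variable {A F : Type*} [Ring A] [FunLike F A A] [RingHomClass F A A] {n : ℕ} {W D : Fin n → A}

theorem map_sortProd_mul_of_raise (φ : F) (hW : ∀ i j, W i * W j = -(W j * W i))
    (hD : ∀ i j, D i * D j = -(D j * D i)) (hWD : ∀ i j, W i * D j = -(D j * W i))
    (hW2 : ∀ i, W i * W i = 0) {i l : Fin n} {I J : Finset (Fin n)}
    (hiI : i ∉ I) (hlI : l ∈ I) (hiJ : i ∈ J) (hlJ : l ∉ J) (hφW : ∀ j, φ (W j) = W j)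
    (hφD : ∀ j, j ≠ i → j ≠ l → φ (D j) = D j)
    (hφl : φ (D l) = D l + W i) (hφi : φ (D i) = D i - W l) :
    φ (sortProd W I * sortProd D (insert l J)) = sortProd W I * sortProd D (insert l J) +
      (-1) ^ (I.card + (I.filter (· < i)).card + (J.filter (· < l)).card) *
        (sortProd W (insert i I) * sortProd D J) := by
  have hφJ : φ (sortProd D J) = sortProd D J - (-1) ^ ((J.erase i).filter (· < i)).card *
      (W l * sortProd D (J.erase i)) := by
    have hK : φ (sortProd D (J.erase i)) = sortProd D (J.erase i) := by
      rw [map_sortProd]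
      refine sortProd_congr fun j hj => hφD j (Finset.ne_of_mem_erase hj) ?_
      rintro rfl
      exact hlJ (Finset.mem_of_mem_erase hj)
    have hJ := sortProd_insert hD i (J.erase i) (Finset.notMem_erase i J)
    rw [Finset.insert_erase hiJ] at hJ
    rw [hJ, map_mul, map_mul, hK, map_pow, map_neg, map_one, hφi, sub_mul, mul_sub]
  have hφI : φ (sortProd W I) = sortProd W I := by
    rw [map_sortProd]
    exact sortProd_congr fun j _ => hφW j
  have hIl : sortProd W I * W l = 0 := sortProd_mul_of_mem hW hW2 hlI
  have hIi : sortProd W I * W i =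
      (-1) ^ (I.card + (I.filter (· < i)).card) * sortProd W (insert i I) := by
    rw [sortProd_mul (fun j => hW j i), mul_sortProd hW i I hiI, pow_add, mul_assoc]
  have hIDl : sortProd W I * D l * W l = 0 := by
    rw [mul_assoc, ← neg_eq_iff_eq_neg.2 (hWD l l), mul_neg, ← mul_assoc, hIl, zero_mul, neg_zero]
  have hIil : sortProd W I * W i * W l = 0 := by
    rw [mul_assoc, hW i l, mul_neg, ← mul_assoc, hIl, zero_mul, neg_zero]
  have hs : ∀ (m : ℕ) (x y : A), x * ((-1) ^ m * y) = (-1) ^ m * (x * y) := fun m x y => by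
    rw [← mul_assoc, ((Commute.neg_one_right x).pow_right m).eq, mul_assoc]
  rw [map_mul, hφI, sortProd_insert hD l J hlJ, map_mul, map_mul, map_pow, map_neg, map_one,
    hφl, hφJ, mul_sub, hs, hs, hs, mul_sub, hs]
  have h0 : sortProd W I * ((D l + W i) * (W l * sortProd D (J.erase i))) = 0 := by
    rw [← mul_assoc, ← mul_assoc, mul_add, add_mul, hIDl, hIil]
    simp
  rw [h0, mul_zero, sub_zero, ← mul_assoc (sortProd W I), mul_add, add_mul, hIi, mul_add,
    add_comm (I.card + _), pow_add _ (J.filter (· < l)).card]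
  simp only [mul_assoc]

theorem map_mul_sortProd_of_shift (φ : F) (hD : ∀ i j, D i * D j = -(D j * D i))
    (hD2 : ∀ i, D i * D i = 0) {m l : Fin n} (hml : m ≠ l) (J : Finset (Fin n)) (hlJ : l ∈ J)
    (hmJ : m ∈ J) (hφl : φ (W l) = W l + W m) (hφD : ∀ j, j ≠ m → φ (D j) = D j)
    (hφm : φ (D m) = D m - D l) :
    φ (W l * sortProd D J) = W l * sortProd D J + W m * sortProd D J := by
  have hK : φ (sortProd D (J.erase m)) = sortProd D (J.erase m) := by
    rw [map_sortProd]
    exact sortProd_congr fun j hj => hφD j (Finset.ne_of_mem_erase hj)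
  have hJ := sortProd_insert hD m (J.erase m) (Finset.notMem_erase m J)
  rw [Finset.insert_erase hmJ] at hJ
  have h0 : D l * sortProd D (J.erase m) = 0 :=
    mul_sortProd_of_mem hD hD2 (Finset.mem_erase.2 ⟨hml.symm, hlJ⟩)
  have hφJ : φ (sortProd D J) = sortProd D J := by
    rw [hJ, map_mul, map_mul, hK, map_pow, map_neg, map_one, hφm, sub_mul, h0, sub_zero]
  rw [map_mul, hφJ, hφl, add_mul]

end MonomialTransforms

theorem ExteriorAlgebra.ι_mul_ι_swap {R M : Type*} [CommRing R] [AddCommGroup M] [Module R M]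
    (x y : M) : ExteriorAlgebra.ι R x * ExteriorAlgebra.ι R y =
      -(ExteriorAlgebra.ι R y * ExteriorAlgebra.ι R x) :=
  eq_neg_of_add_eq_zero_left (ExteriorAlgebra.ι_add_mul_swap x y)

theorem Qq_eW {n : ℕ} (i : Fin n) : Qq n (eW n i) = 0 := by
  simp [Qq_apply, eW]

theorem Qq_eD {n : ℕ} (i : Fin n) : Qq n (eD n i) = 0 := by
  simp [Qq_apply, eD]

theorem polar_eW_eW {n : ℕ} (i j : Fin n) : QuadraticMap.polar (Qq n) (eW n i) (eW n j) = 0 := by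
  simp [polar_Qq, eW]

theorem polar_eD_eD {n : ℕ} (i j : Fin n) : QuadraticMap.polar (Qq n) (eD n i) (eD n j) = 0 := by
  simp [polar_Qq, eD]

theorem polar_eW_eD {n : ℕ} (i j : Fin n) :
    QuadraticMap.polar (Qq n) (eW n i) (eD n j) = if i = j then 1 else 0 := by
  simp [polar_Qq, eW, eD, Pi.single_apply]

theorem polar_eD_eW {n : ℕ} (i j : Fin n) :
    QuadraticMap.polar (Qq n) (eD n i) (eW n j) = if i = j then 1 else 0 := by
  rw [QuadraticMap.polar_comm, polar_eW_eD]
  simp [eq_comm]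

theorem map_eII_of_raise {n : ℕ} {i l : Fin n} {I J : Finset (Fin n)}
    (hiI : i ∉ I) (hlI : l ∈ I) (hiJ : i ∈ J) (hlJ : l ∉ J) (hcard : I.card + J.card = n) :
    ((eII I (insert l J) + ((-1 : ℂ) ^ (I.card + (I.filter (· < i)).card +
        (J.filter (· < l)).card)) • eII (insert i I) J : ↥(⋀[ℂ]^(n + 1) (V n))) :
          ExteriorAlgebra ℂ (V n)) =
      ExteriorAlgebra.map (transvec (Qq n) (eW n i) (eW n l)) (eII I (insert l J)) := by
  have hil : i ≠ l := fun h => hiI (h ▸ hlI)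
  have hc1 : I.card + (insert l J).card = n + 1 := by
    rw [Finset.card_insert_of_notMem hlJ]; omega
  have hc2 : (insert i I).card + J.card = n + 1 := by
    rw [Finset.card_insert_of_notMem hiI]; omega
  rw [Submodule.coe_add, Submodule.coe_smul, eII_coe hc1, eII_coe hc2, ← neg_one_pow_mul_eq_smul]
  symm
  apply map_sortProd_mul_of_raise (ExteriorAlgebra.map (transvec (Qq n) (eW n i) (eW n l)))
    (fun _ _ => ExteriorAlgebra.ι_mul_ι_swap _ _) (fun _ _ => ExteriorAlgebra.ι_mul_ι_swap _ _)
    (fun _ _ => ExteriorAlgebra.ι_mul_ι_swap _ _) (fun _ => ExteriorAlgebra.ι_sq_zero _)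
    hiI hlI hiJ hlJ
  · intro j
    simp [transvec_apply, polar_eW_eW]
  · intro j hji hjl
    simp [transvec_apply, polar_eW_eD, hji.symm, hjl.symm]
  · simp [transvec_apply, polar_eW_eD, hil]
  · simp [transvec_apply, polar_eW_eD, hil.symm]

theorem map_eII_of_shift {n : ℕ} {m l : Fin n} (hml : m ≠ l) :
    ((eII {l} Finset.univ + eII {m} Finset.univ : ↥(⋀[ℂ]^(n + 1) (V n))) :
          ExteriorAlgebra ℂ (V n)) =
      ExteriorAlgebra.map (transvec (Qq n) (eW n m) (eD n l)) (eII {l} Finset.univ) := by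
  have hc (j : Fin n) : ({j} : Finset (Fin n)).card + (Finset.univ : Finset (Fin n)).card =
      n + 1 := by
    simp [add_comm]
  rw [Submodule.coe_add, eII_coe (hc l), eII_coe (hc m), sortProd_singleton, sortProd_singleton]
  symm
  apply map_mul_sortProd_of_shift (W := fun j => ExteriorAlgebra.ι ℂ (eW n j))
    (ExteriorAlgebra.map (transvec (Qq n) (eW n m) (eD n l)))
    (fun _ _ => ExteriorAlgebra.ι_mul_ι_swap _ _) (fun _ => ExteriorAlgebra.ι_sq_zero _)
    hml _ (Finset.mem_univ l) (Finset.mem_univ m)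
  · simp [transvec_apply, polar_eW_eW, polar_eD_eW]
  · intro j hjm
    simp [transvec_apply, polar_eW_eD, polar_eD_eD, hjm.symm]
  · simp [transvec_apply, polar_eW_eD, polar_eD_eD]

/-- Equivariance of a linear map `Λ^{n+1}(W ⊕ W^∨) → S ⊗ S` under the spin group. -/
def SpinEquivariant {n : ℕ} (p : ↥(⋀[ℂ]^(n + 1) (V n)) →ₗ[ℂ] (TensorProduct ℂ (SS n) (SS n))) :
    Prop :=
  ∀ g : Cl n, SpinG g → ∀ T : V n →ₗ[ℂ] V n,
    (∀ x : V n, CliffordAlgebra.ι (Qq n) (T x) =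
      CliffordAlgebra.involute g * CliffordAlgebra.ι (Qq n) x * conjC g) →
    ∀ hT : ∀ y ∈ ⋀[ℂ]^(n + 1) (V n), ExteriorAlgebra.map T y ∈ ⋀[ℂ]^(n + 1) (V n),
    ∀ ω : ↥(⋀[ℂ]^(n + 1) (V n)),
      p ((ExteriorAlgebra.map T).toLinearMap.restrict hT ω) =
        TensorProduct.map (Gamma n g) (Gamma n g) (p ω)

section Equivariant

variable {n : ℕ} {p : ↥(⋀[ℂ]^(n + 1) (V n)) →ₗ[ℂ] (TensorProduct ℂ (SS n) (SS n))}

theorem SpinEquivariant.apply_transvec (hp : SpinEquivariant p) {a b : V n} (ha : Qq n a = 0)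
    (hb : Qq n b = 0) (hab : QuadraticMap.polar (Qq n) a b = 0) {ω ω' : ↥(⋀[ℂ]^(n + 1) (V n))}
    (h : (ω' : ExteriorAlgebra ℂ (V n)) = ExteriorAlgebra.map (transvec (Qq n) a b) ω) :
    p ω' = TensorProduct.map
      (Gamma n (1 + CliffordAlgebra.ι (Qq n) a * CliffordAlgebra.ι (Qq n) b))
      (Gamma n (1 + CliffordAlgebra.ι (Qq n) a * CliffordAlgebra.ι (Qq n) b)) (p ω) := by
  rw [← hp _ (spinG_one_add ha hb hab) (transvec (Qq n) a b) _
    fun y hy => ExteriorAlgebra.map_mem_exteriorPower _ _ hy]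
  · congr 1
    exact Subtype.ext h
  · intro x
    rw [transvec_conj _ ha hb hab, conjC_one_add hab]
    simp

theorem eS_eq_sortProd (J : Finset (Fin n)) :
    eS J = sortProd (fun i => ExteriorAlgebra.ι ℂ (Pi.single i (1 : ℂ) : Fin n → ℂ)) J := rfl

theorem Gamma_transvec_eS_of_mem {i l : Fin n} {I : Finset (Fin n)} (hl : l ∈ I) :
    Gamma n (1 + CliffordAlgebra.ι (Qq n) (eW n i) * CliffordAlgebra.ι (Qq n) (eW n l)) (eS I) =
      eS I := by
  rw [map_add, map_one (Gamma n), map_mul, LinearMap.add_apply, Module.End.mul_apply, Gamma_eW, Gamma_eW,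
    eS_eq_sortProd, mul_sortProd_of_mem (f := fun i => ExteriorAlgebra.ι ℂ (Pi.single i (1 : ℂ)))
      (fun _ _ => ExteriorAlgebra.ι_mul_ι_swap _ _) (fun _ => ExteriorAlgebra.ι_sq_zero _) hl]
  simp

theorem Gamma_transvec_eS_erase {i l : Fin n} {I : Finset (Fin n)} (hl : l ∈ I) (hi : i ∉ I) :
    Gamma n (1 + CliffordAlgebra.ι (Qq n) (eW n i) * CliffordAlgebra.ι (Qq n) (eW n l))
        (eS (I.erase l)) =
      eS (I.erase l) + ((-1 : ℂ) ^ (((I.erase l).filter (· < l)).card +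
        (I.filter (· < i)).card)) • eS (insert i I) := by
  have hsw (i j : Fin n) := ExteriorAlgebra.ι_mul_ι_swap (R := ℂ)
    (Pi.single i (1 : ℂ) : Fin n → ℂ) (Pi.single j (1 : ℂ))
  rw [map_add, map_one (Gamma n), map_mul, LinearMap.add_apply, Module.End.mul_apply, Gamma_eW, Gamma_eW,
    eS_eq_sortProd, mul_sortProd hsw l _ (Finset.notMem_erase l I), Finset.insert_erase hl,
    neg_one_pow_mul_eq_smul, mul_smul_comm, mul_sortProd hsw i _ hi, neg_one_pow_mul_eq_smul,
    smul_smul, ← pow_add]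
  rfl

theorem SpinEquivariant.apply_eII_singleton (hp : SpinEquivariant p) {c : ℂ} {l : Fin n}
    (h : p (eII {l} Finset.univ) = c • ((1 : SS n) ⊗ₜ[ℂ] eS {l})) (m : Fin n) :
    p (eII {m} Finset.univ) = c • ((1 : SS n) ⊗ₜ[ℂ] eS {m}) := by
  by_cases hml : m = l
  · rw [hml, h]
  have key := hp.apply_transvec (Qq_eW m) (Qq_eD l) (by rw [polar_eW_eD, if_neg hml])
    (map_eII_of_shift hml)
  have h1 : Gamma n (1 + CliffordAlgebra.ι (Qq n) (eW n m) * CliffordAlgebra.ι (Qq n) (eD n l)) 1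
      = 1 := by
    rw [map_add, map_one (Gamma n), map_mul, LinearMap.add_apply, Module.End.mul_apply, Gamma_eW, Gamma_eD]
    have : CliffordAlgebra.contractLeft (Q := (0 : QuadraticForm ℂ (Fin n → ℂ)))
        (LinearMap.proj l) (1 : SS n) = 0 :=
      CliffordAlgebra.contractLeft_one (Q := (0 : QuadraticForm ℂ (Fin n → ℂ))) _
    simp [this]
  have h2 : Gamma n (1 + CliffordAlgebra.ι (Qq n) (eW n m) * CliffordAlgebra.ι (Qq n) (eD n l))
      (eS {l}) = eS {l} + eS {m} := by
    rw [map_add, map_one (Gamma n), map_mul, LinearMap.add_apply, Module.End.mul_apply, Gamma_eW, Gamma_eD]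
    have : CliffordAlgebra.contractLeft (Q := (0 : QuadraticForm ℂ (Fin n → ℂ)))
        (LinearMap.proj l) (eS {l} : SS n) = algebraMap ℂ _ (LinearMap.proj (R := ℂ)
          (φ := fun _ : Fin n => ℂ) l (Pi.single l 1)) := by
      rw [eS_eq_sortProd, sortProd_singleton]
      exact CliffordAlgebra.contractLeft_ι (Q := (0 : QuadraticForm ℂ (Fin n → ℂ))) _ _
    rw [this]
    simp [eS]
  rw [map_add, h, map_smul, TensorProduct.map_tmul, h1, h2, TensorProduct.tmul_add, smul_add]
    at key
  exact add_left_cancel key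

/-- The tensor `e_I ⊗ e_A` if `#I` is even, and `e_A ⊗ e_I` otherwise. -/
def evenOddTmul (I A : Finset (Fin n)) : TensorProduct ℂ (SS n) (SS n) :=
  if Even I.card then eS I ⊗ₜ[ℂ] eS A else eS A ⊗ₜ[ℂ] eS I

theorem SpinEquivariant.apply_eII_insert (hp : SpinEquivariant p) {i l : Fin n}
    {I J : Finset (Fin n)} {c : ℂ} (hiI : i ∉ I) (hlI : l ∈ I) (hiJ : i ∈ J) (hlJ : l ∉ J)
    (hcard : I.card + J.card = n)
    (h : p (eII I (insert l J)) = c • evenOddTmul I (I.erase l)) :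
    p (eII (insert i I) J) = (c * (-1) ^ (I.card + ((I.erase l).filter (· < l)).card +
      (J.filter (· < l)).card)) • evenOddTmul (insert i I) I := by
  have key := hp.apply_transvec (Qq_eW i) (Qq_eW l) (polar_eW_eW i l)
    (map_eII_of_raise hiI hlI hiJ hlJ hcard)
  rw [map_add, map_smul, h, map_smul] at key
  have hmap : TensorProduct.map
      (Gamma n (1 + CliffordAlgebra.ι (Qq n) (eW n i) * CliffordAlgebra.ι (Qq n) (eW n l)))
      (Gamma n (1 + CliffordAlgebra.ι (Qq n) (eW n i) * CliffordAlgebra.ι (Qq n) (eW n l)))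
      (evenOddTmul I (I.erase l)) = evenOddTmul I (I.erase l) +
        ((-1 : ℂ) ^ (((I.erase l).filter (· < l)).card +
          (I.filter (· < i)).card)) • evenOddTmul (insert i I) I := by
    unfold evenOddTmul
    rw [Finset.card_insert_of_notMem hiI]
    by_cases hI : Even I.card
    · rw [if_pos hI, if_neg (by simpa [Nat.even_add_one] using hI), TensorProduct.map_tmul,
        Gamma_transvec_eS_of_mem hlI, Gamma_transvec_eS_erase hlI hiI, TensorProduct.tmul_add,
        TensorProduct.tmul_smul]
    · rw [if_neg hI, if_pos (by simpa [Nat.even_add_one] using hI), TensorProduct.map_tmul,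
        Gamma_transvec_eS_of_mem hlI, Gamma_transvec_eS_erase hlI hiI, TensorProduct.add_tmul,
        TensorProduct.smul_tmul']
  rw [hmap, smul_add] at key
  have key' := congrArg (fun x => ((-1 : ℂ) ^ (I.card + (I.filter (· < i)).card +
    (J.filter (· < l)).card)) • x) (add_left_cancel key)
  simp only [smul_smul, ← pow_add, (Even.add_self _).neg_one_pow, one_smul] at key'
  rw [key']
  congr 1
  have h2 : ((-1 : ℂ) ^ (I.filter (· < i)).card) * (-1) ^ (I.filter (· < i)).card = 1 := by
    rw [← pow_add, (Even.add_self _).neg_one_pow]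
  simp only [pow_add]
  linear_combination (c * (-1) ^ I.card * (-1) ^ (J.filter (· < l)).card *
    (-1) ^ ((I.erase l).filter (· < l)).card) * h2

theorem card_filter_lt_add_card_filter_lt {A J : Finset (Fin n)} {l : Fin n} (hlA : l ∉ A)
    (hlJ : l ∉ J) (hAJ : Disjoint A J) (hcard : A.card + J.card + 1 = n) :
    (A.filter (· < l)).card + (J.filter (· < l)).card = (l : ℕ) := by
  have hu : A ∪ J = Finset.univ.erase l := by
    apply Finset.eq_of_subset_of_card_le
    · intro j hj
      refine Finset.mem_erase.2 ⟨?_, Finset.mem_univ j⟩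
      rintro rfl
      exact (Finset.mem_union.1 hj).elim hlA hlJ
    · rw [Finset.card_union_of_disjoint hAJ, Finset.card_erase_of_mem (Finset.mem_univ l)]
      simp
      omega
  rw [← Finset.card_union_of_disjoint (Finset.disjoint_filter_filter hAJ), ← Finset.filter_union,
    hu, ← Fin.card_Iio l]
  congr 1
  ext j
  simp +contextual [ne_of_lt]

theorem sgn4_eq_of_card {I A : Finset (Fin n)} (h : I.card = A.card + 2) :
    sgn4 I = (-1) ^ (A.card + 1) * sgn4 A := by
  unfold sgn4
  rw [h]
  have hA : A.card = 4 * (A.card / 4) + A.card % 4 := by omega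
  generalize A.card / 4 = q at hA
  have hr : A.card % 4 < 4 := Nat.mod_lt _ (by norm_num)
  generalize A.card % 4 = r at hA hr
  rw [hA]
  have h1 : ((-1 : ℂ)) ^ (4 * q) = 1 := (Even.mul_right (by decide) q).neg_one_pow
  rw [add_assoc (4 * q) r 1, add_assoc (4 * q) r 2, pow_add, h1, Nat.mul_add_mod]
  interval_cases r <;> norm_num

theorem SpinEquivariant.apply_eII (hp : SpinEquivariant p) (hn : 0 < n)
    (hnorm : p (eII {⟨0, hn⟩} Finset.univ) =
      ((-1 : ℂ) ^ (n * (n - 1) / 2)) • ((1 : SS n) ⊗ₜ[ℂ] eS {⟨0, hn⟩})) (k : ℕ) :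
    ∀ (I J : Finset (Fin n)) (l : Fin n), I.card = k + 1 → I.card + J.card = n + 1 →
      I ∩ J = {l} →
      p (eII I J) = ((-1 : ℂ) ^ (∑ j ∈ J, (j : ℕ)) * (sgn4 I * sgn4 (I.erase l))) •
        evenOddTmul I (I.erase l) := by
  induction k with
  | zero =>
    intro I J l hI hIJ hl
    obtain ⟨m, rfl⟩ := Finset.card_eq_one.1 hI
    have hJ : J = Finset.univ := by
      rw [← Finset.card_eq_iff_eq_univ, Fintype.card_fin]
      omega
    subst hJ
    obtain rfl : m = l := by simpa using hl
    rw [hp.apply_eII_singleton hnorm m]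
    have hs : ∑ j : Fin n, (j : ℕ) = n * (n - 1) / 2 := by
      rw [Fin.sum_univ_eq_sum_range (fun j => j), Finset.sum_range_id]
    simp [evenOddTmul, sgn4, hs, eS_eq_sortProd, sortProd_empty]
  | succ k ih =>
    intro I J i hI hIJ hi
    have hiIJ : i ∈ I ∩ J := hi ▸ Finset.mem_singleton_self i
    obtain ⟨hiI, hiJ⟩ := Finset.mem_inter.1 hiIJ
    have hcI : (I.erase i).card = k + 1 := by rw [Finset.card_erase_of_mem hiI, hI]; rfl
    obtain ⟨l, hlI⟩ : (I.erase i).Nonempty := Finset.card_pos.1 (by omega)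
    obtain ⟨hli, hlI0⟩ := Finset.mem_erase.1 hlI
    have hdisj : ∀ j ∈ I, j ∈ J → j = i := fun j h1 h2 =>
      Finset.mem_singleton.1 (hi ▸ Finset.mem_inter.2 ⟨h1, h2⟩)
    have hlJ : l ∉ J := fun h => hli (hdisj l hlI0 h)
    have hinter : I.erase i ∩ insert l J = {l} := by
      ext j
      simp only [Finset.mem_inter, Finset.mem_erase, Finset.mem_insert, Finset.mem_singleton]
      constructor
      · rintro ⟨⟨h1, h2⟩, h3 | h3⟩
        · exact h3
        · exact absurd (hdisj j h2 h3) h1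
      · rintro rfl
        exact ⟨⟨hli, hlI0⟩, Or.inl rfl⟩
    have hcA : ((I.erase i).erase l).card = k := by
      rw [Finset.card_erase_of_mem hlI, hcI]; rfl
    have h := ih (I.erase i) (insert l J) l hcI
      (by rw [Finset.card_insert_of_notMem hlJ]; omega) hinter
    have h' := hp.apply_eII_insert (Finset.notMem_erase i I) hlI hiJ hlJ (by omega) h
    rw [Finset.insert_erase hiI] at h'
    rw [h']
    congr 1
    have hl : (((I.erase i).erase l).filter (· < l)).card + (J.filter (· < l)).card = (l : ℕ) := by
      refine card_filter_lt_add_card_filter_lt (Finset.notMem_erase l _) hlJ ?_ (by omega)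
      rw [Finset.disjoint_left]
      intro j h1 h2
      obtain ⟨h3, h4⟩ := Finset.mem_erase.1 (Finset.mem_of_mem_erase h1)
      exact h3 (hdisj j h4 h2)
    have hll : ((-1 : ℂ) ^ (l : ℕ)) * (-1) ^ (l : ℕ) = 1 := by
      rw [← pow_add, (Even.add_self _).neg_one_pow]
    rw [sgn4_eq_of_card (I := I) (A := (I.erase i).erase l) (by omega), add_assoc, hl,
      Finset.sum_insert hlJ, hcA, hcI, pow_add _ (l : ℕ), pow_add _ (k + 1)]
    linear_combination ((-1 : ℂ) ^ (∑ j ∈ J, (j : ℕ)) * sgn4 (I.erase i) *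
      sgn4 ((I.erase i).erase l) * (-1) ^ (k + 1)) * hll

end Equivariant

theorem spin_equivariant_map_on_wedge_basis (n : ℕ) (hn : 0 < n)
    (p : ↥(⋀[ℂ]^(n + 1) (V n)) →ₗ[ℂ] (TensorProduct ℂ (SS n) (SS n)))
    -- `p` takes values in `S₊ ⊗ S₋`:
    (hrange : ∀ ω, p ω ∈ LinearMap.range (TensorProduct.map
      (CliffordAlgebra.evenOdd (0 : QuadraticForm ℂ (Fin n → ℂ)) 0).subtype
      (CliffordAlgebra.evenOdd (0 : QuadraticForm ℂ (Fin n → ℂ)) 1).subtype))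
    -- `p` is `Spin(Q)`-equivariant, where `g ∈ Spin(Q)` acts on `Λ^{n+1}ℂ^{2n}` via the
    -- `(n+1)`-st exterior power of `ρ(g)` and on `S₊ ⊗ S₋` via `Γ ⊗ Γ`:
    (hequiv : ∀ g : Cl n, SpinG g → ∀ T : V n →ₗ[ℂ] V n,
      (∀ x : V n, CliffordAlgebra.ι (Qq n) (T x) =
        CliffordAlgebra.involute g * CliffordAlgebra.ι (Qq n) x * conjC g) →
      ∀ hT : ∀ y ∈ ⋀[ℂ]^(n + 1) (V n),
        ExteriorAlgebra.map T y ∈ ⋀[ℂ]^(n + 1) (V n),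
      ∀ ω : ↥(⋀[ℂ]^(n + 1) (V n)),
        p ((ExteriorAlgebra.map T).toLinearMap.restrict hT ω) =
          TensorProduct.map (Gamma n g) (Gamma n g) (p ω))
    -- the normalization `p(e_{{1},[n]}) = (−1)^{n(n−1)/2} (1 ⊗ e₁)`:
    (hnorm : p (eII {⟨0, hn⟩} Finset.univ) =
      ((-1 : ℂ) ^ (n * (n - 1) / 2)) •
        ((1 : SS n) ⊗ₜ[ℂ] ExteriorAlgebra.ι ℂ (Pi.single (⟨0, hn⟩ : Fin n) 1))) :
    ∀ (I Id : Finset (Fin n)) (l : Fin n),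
      I.card + Id.card = n + 1 → I ∩ Id = {l} →
      (Even I.card →
        ((-1 : ℂ) ^ (∑ j ∈ Id, (j : ℕ))) • p (eII I Id) =
          (sgn4 I * sgn4 (I.erase l)) • (eS I ⊗ₜ[ℂ] eS (I.erase l))) ∧
      (Odd I.card →
        ((-1 : ℂ) ^ (∑ j ∈ Id, (j : ℕ))) • p (eII I Id) =
          (sgn4 I * sgn4 (I.erase l)) • (eS (I.erase l) ⊗ₜ[ℂ] eS I)) := by
  have hp : SpinEquivariant p := hequiv
  intro I Id l hcard hinter
  have hl : l ∈ I := (Finset.mem_inter.1 (hinter ▸ Finset.mem_singleton_self l)).1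
  have hpos : 0 < I.card := Finset.card_pos.2 ⟨l, hl⟩
  have hnorm' : p (eII {⟨0, hn⟩} Finset.univ) =
      ((-1 : ℂ) ^ (n * (n - 1) / 2)) • ((1 : SS n) ⊗ₜ[ℂ] eS {⟨0, hn⟩}) := by
    rw [hnorm, eS_eq_sortProd, sortProd_singleton]
  have key := hp.apply_eII hn hnorm' (I.card - 1) I Id l (by omega) hcard hinter
  have hsign : ((-1 : ℂ) ^ (∑ j ∈ Id, (j : ℕ))) • p (eII I Id) =
      (sgn4 I * sgn4 (I.erase l)) • evenOddTmul I (I.erase l) := by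
    rw [key, smul_smul, ← mul_assoc, ← pow_add, (Even.add_self _).neg_one_pow, one_mul]
  rw [hsign]
  exact ⟨fun h => by rw [evenOddTmul, if_pos h],
    fun h => by rw [evenOddTmul, if_neg (Nat.not_even_iff_odd.2 h)]⟩
end
end

section
/- Fix n ≥ 1 and let p : Λ^{n+1}ℂ^{2n} → S_+ ⊗ S_− be a linear map that is Spin(Q)-equivariant and satisfies p(e_{{1},[n]}) = (−1)^{n(n−1)/2} · (1 ⊗ e_1). Suppose v ∈ Λ^{n+1}ℂ^{2n}, s_+ ∈ S_+ and s_− ∈ S_− satisfy p(v) = s_+ ⊗ s_−. For J ⊆ [n], write Σ_J for the coefficient of σ(J) e_J in s_+ when #J is even, and in s_− when #J is odd. Let I, I^∨ ⊆ [n] with #I + #I^∨ = n+1 and #(I ∩ I^∨) = 1, and let Δ denote the coefficient of e_{I,I^∨} when v is expanded in the basis {e_{K,K^∨} : K, K^∨ ⊆ [n], #K + #K^∨ = n+1} of Λ^{n+1}(W ⊕ W^∨). Then (−1)^{Σ_{j∈I^∨}(j−1)} Δ = Σ_I · Σ_{[n]∖I^∨}. -/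
open scoped TensorProduct

noncomputable section

/-! ### Ordered wedge products -/

/-- The number of elements of `I` below `i`. -/
def numBelow {n : ℕ} (i : Fin n) (I : Finset (Fin n)) : ℕ := (I.filter (· < i)).card

theorem numBelow_erase {n : ℕ} (i : Fin n) (I : Finset (Fin n)) :
    numBelow i (I.erase i) = numBelow i I := by
  unfold numBelow
  congr 1
  ext k
  simp only [Finset.mem_filter, Finset.mem_erase]
  exact ⟨fun h => ⟨h.1.2, h.2⟩, fun h => ⟨⟨h.2.ne, h.1⟩, h.2⟩⟩

section Wedge

variable {M : Type*} [AddCommGroup M] [Module ℂ M] {n : ℕ}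

/-- The wedge product of the vectors `u i`, `i ∈ I`, taken in increasing order. -/
def wedgeProd (u : Fin n → M) (I : Finset (Fin n)) : ExteriorAlgebra ℂ M :=
  ((I.sort (· ≤ ·)).map fun i => ExteriorAlgebra.ι ℂ (u i)).prod

theorem exteriorAlgebra_ι_mul_swap (x y : M) :
    ExteriorAlgebra.ι ℂ x * ExteriorAlgebra.ι ℂ y =
      -(ExteriorAlgebra.ι ℂ y * ExteriorAlgebra.ι ℂ x) :=
  eq_neg_of_add_eq_zero_left (ExteriorAlgebra.ι_add_mul_swap x y)

theorem ι_mul_list_prod_eq_orderedInsert (u : Fin n → M) (i : Fin n) (l : List (Fin n))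
    (hl : l.Pairwise (· ≤ ·)) :
    ExteriorAlgebra.ι ℂ (u i) * (l.map fun k => ExteriorAlgebra.ι ℂ (u k)).prod =
      (-1 : ℂ) ^ (l.countP (· < i)) •
        ((l.orderedInsert (· ≤ ·) i).map fun k => ExteriorAlgebra.ι ℂ (u k)).prod := by
  induction l with
  | nil => simp
  | cons b l ih =>
    by_cases h : i ≤ b
    · have h0 : (b :: l).countP (· < i) = 0 := by
        rw [List.countP_eq_zero]
        intro k hk
        rcases List.mem_cons.1 hk with rfl | hk
        · simpa using h
        · simpa using h.trans (List.rel_of_pairwise_cons hl hk)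
      rw [h0, List.orderedInsert_cons_of_le _ _ h]
      simp
    · rw [List.orderedInsert_of_not_le _ _ h, List.countP_cons_of_pos (by simpa using h)]
      simp only [List.map_cons, List.prod_cons]
      rw [← mul_assoc, exteriorAlgebra_ι_mul_swap, neg_mul, mul_assoc, ih hl.of_cons, pow_succ]
      simp


theorem ι_mul_wedgeProd (u : Fin n → M) {i : Fin n} {I : Finset (Fin n)} (hi : i ∉ I) :
    ExteriorAlgebra.ι ℂ (u i) * wedgeProd u I =
      (-1 : ℂ) ^ numBelow i I • wedgeProd u (insert i I) := by
  have hs : (insert i I).sort (· ≤ ·) = (I.sort (· ≤ ·)).orderedInsert (· ≤ ·) i := by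
    refine List.Perm.eq_of_pairwise' (r := (· ≤ ·)) (Finset.pairwise_sort _ _)
      (List.Pairwise.orderedInsert _ _ (Finset.pairwise_sort _ _)) ?_
    refine List.Perm.trans ?_ (List.perm_orderedInsert _ _ _).symm
    rw [List.perm_ext_iff_of_nodup (Finset.sort_nodup _ _)
      (List.nodup_cons.2 ⟨by simpa using hi, Finset.sort_nodup _ _⟩)]
    simp
  have hc : (I.sort (· ≤ ·)).countP (· < i) = numBelow i I := by
    rw [List.countP_eq_length_filter, numBelow,
      ← List.toFinset_card_of_nodup ((Finset.sort_nodup _ _).filter _)]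
    congr 1
    ext k
    simp
  rw [wedgeProd, ι_mul_list_prod_eq_orderedInsert u i _ (Finset.pairwise_sort _ _), hc, wedgeProd,
    hs]

theorem wedgeProd_eq_ι_mul_erase (u : Fin n → M) {i : Fin n} {I : Finset (Fin n)} (hi : i ∈ I) :
    wedgeProd u I =
      (-1 : ℂ) ^ numBelow i I • (ExteriorAlgebra.ι ℂ (u i) * wedgeProd u (I.erase i)) := by
  rw [ι_mul_wedgeProd u (Finset.notMem_erase i I), Finset.insert_erase hi, smul_smul,
    numBelow_erase,
    ← mul_pow]
  simp

theorem ι_mul_wedgeProd_of_mem (u : Fin n → M) {i : Fin n} {I : Finset (Fin n)} (hi : i ∈ I) :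
    ExteriorAlgebra.ι ℂ (u i) * wedgeProd u I = 0 := by
  rw [wedgeProd_eq_ι_mul_erase u hi, mul_smul_comm, ← mul_assoc, ExteriorAlgebra.ι_sq_zero,
    zero_mul, smul_zero]

theorem wedgeProd_mul_ι (u : Fin n → M) (I : Finset (Fin n)) (x : M) :
    wedgeProd u I * ExteriorAlgebra.ι ℂ x =
      (-1 : ℂ) ^ I.card • (ExteriorAlgebra.ι ℂ x * wedgeProd u I) := by
  have key : ∀ l : List (Fin n),
      (l.map fun k => ExteriorAlgebra.ι ℂ (u k)).prod * ExteriorAlgebra.ι ℂ x =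
        (-1 : ℂ) ^ l.length •
          (ExteriorAlgebra.ι ℂ x * (l.map fun k => ExteriorAlgebra.ι ℂ (u k)).prod) := by
    intro l
    induction l with
    | nil => simp
    | cons b l ih =>
      simp only [List.map_cons, List.prod_cons, List.length_cons]
      rw [mul_assoc, ih, mul_smul_comm, ← mul_assoc, exteriorAlgebra_ι_mul_swap, pow_succ,
        neg_mul, mul_assoc]
      simp
  simpa [wedgeProd] using key (I.sort (· ≤ ·))

theorem wedgeProd_mul_ι_of_mem (u : Fin n → M) {i : Fin n} {I : Finset (Fin n)} (hi : i ∈ I) :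
    wedgeProd u I * ExteriorAlgebra.ι ℂ (u i) = 0 := by
  rw [wedgeProd_mul_ι, ι_mul_wedgeProd_of_mem u hi, smul_zero]

theorem map_wedgeProd (T : M →ₗ[ℂ] M) (u : Fin n → M) (I : Finset (Fin n)) :
    ExteriorAlgebra.map T (wedgeProd u I) = wedgeProd (fun i => T (u i)) I := by
  simp [wedgeProd, map_list_prod, Function.comp_def]

theorem wedgeProd_congr {u u' : Fin n → M} {I : Finset (Fin n)} (h : ∀ i ∈ I, u i = u' i) :
    wedgeProd u I = wedgeProd u' I := by
  unfold wedgeProd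
  congr 1
  refine List.map_congr_left fun i hi => ?_
  rw [h i (by simpa using hi)]

theorem wedgeProd_smul (a : Fin n → ℂ) (u : Fin n → M) (I : Finset (Fin n)) :
    wedgeProd (fun i => a i • u i) I = (∏ i ∈ I, a i) • wedgeProd u I := by
  have key : ∀ l : List (Fin n), (l.map fun i => ExteriorAlgebra.ι ℂ (a i • u i)).prod =
      (l.map a).prod • (l.map fun i => ExteriorAlgebra.ι ℂ (u i)).prod := by
    intro l
    induction l with
    | nil => simp
    | cons b l ih =>
      simp only [List.map_cons, List.prod_cons]
      rw [ih, map_smul, smul_mul_smul_comm]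
  have hp : ((I.sort (· ≤ ·)).map a).prod = ∏ i ∈ I, a i := by
    rw [← Finset.prod_map_toList]
    exact ((Finset.sort_perm_toList I _).map a).prod_eq
  rw [wedgeProd, key, hp, wedgeProd]

end Wedge

theorem coe_eII {n : ℕ} {I Id : Finset (Fin n)} (h : I.card + Id.card = n + 1) :
    (eII I Id : ExteriorAlgebra ℂ (V n)) = wedgeProd (eW n) I * wedgeProd (eD n) Id := by
  set l := (I.sort (· ≤ ·)).map (eW n) ++ (Id.sort (· ≤ ·)).map (eD n) with hl
  have hlen : l.length = n + 1 := by simp [hl, h]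
  have h1 : (List.ofFn fun s : Fin (n + 1) => ExteriorAlgebra.ι ℂ (l.getD (s : ℕ) 0)) =
      l.map (ExteriorAlgebra.ι ℂ) := by
    refine List.ext_getElem (by simp [hlen]) fun k hk hk' => ?_
    have : k < l.length := by simpa using hk'
    simp [this, -List.ofFn_succ]
  have h2 : (eII I Id : ExteriorAlgebra ℂ (V n)) = (l.map (ExteriorAlgebra.ι ℂ)).prod := by
    rw [← h1]
    exact ExteriorAlgebra.ιMulti_apply _
  rw [h2, hl]
  simp [wedgeProd, Function.comp_def]

/-! ### Elements of the spin group built from a pair of isotropic vectors -/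

theorem polar_Qq_s7 {n : ℕ} (x y : V n) : QuadraticMap.polar (Qq n) x y = 2 * Bform n x y := by
  have hq : ∀ z : V n, Qq n z = Bform n z z := fun _ => rfl
  have hs : Bform n y x = Bform n x y := by simp [Bform, add_comm]
  simp only [QuadraticMap.polar, hq, map_add, LinearMap.add_apply, hs]
  ring

/-- The map `z ↦ z + 2a Q(y,z) x + 2b Q(x,z) y`. -/
def twoPlaneMap {n : ℕ} (a b : ℂ) (x y : V n) : V n →ₗ[ℂ] V n :=
  LinearMap.id + ((2 * a) • Bform n y).smulRight x + ((2 * b) • Bform n x).smulRight y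

theorem twoPlaneMap_apply {n : ℕ} (a b : ℂ) (x y z : V n) :
    twoPlaneMap a b x y z = z + (2 * a * Bform n y z) • x + (2 * b * Bform n x z) • y := by
  simp [twoPlaneMap]

theorem cl_ι_sq {n : ℕ} {x : V n} (hx : Bform n x x = 0) :
    CliffordAlgebra.ι (Qq n) x * CliffordAlgebra.ι (Qq n) x = 0 := by
  rw [CliffordAlgebra.ι_sq_scalar]
  have : Qq n x = Bform n x x := rfl
  rw [this, hx, map_zero]

theorem cl_ι_mul_comm {n : ℕ} (x y : V n) :
    CliffordAlgebra.ι (Qq n) y * CliffordAlgebra.ι (Qq n) x =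
      (2 * Bform n x y) • 1 - CliffordAlgebra.ι (Qq n) x * CliffordAlgebra.ι (Qq n) y := by
  rw [eq_sub_iff_add_eq, add_comm, CliffordAlgebra.ι_mul_ι_add_swap, polar_Qq_s7,
    Algebra.algebraMap_eq_smul_one]

/-- The element `r + s x y` of the Clifford algebra. -/
def twoPlaneElt {n : ℕ} (r s : ℂ) (x y : V n) : Cl n :=
  r • 1 + s • (CliffordAlgebra.ι (Qq n) x * CliffordAlgebra.ι (Qq n) y)

theorem involute_twoPlaneElt {n : ℕ} (r s : ℂ) (x y : V n) :
    CliffordAlgebra.involute (twoPlaneElt r s x y) = twoPlaneElt r s x y := by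
  simp [twoPlaneElt]

theorem conjC_twoPlaneElt {n : ℕ} (r s : ℂ) (x y : V n) :
    conjC (twoPlaneElt r s x y) = twoPlaneElt r s y x := by
  rw [conjC, involute_twoPlaneElt]
  simp [twoPlaneElt, CliffordAlgebra.reverse.map_mul]

theorem twoPlaneElt_mul_swap {n : ℕ} {r s : ℂ} {x y : V n}
    (hy : Bform n y y = 0) (hr : r * r + r * s * (2 * Bform n x y) = 1) :
    twoPlaneElt r s x y * twoPlaneElt r s y x = 1 := by
  have h1 : CliffordAlgebra.ι (Qq n) x * CliffordAlgebra.ι (Qq n) y *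
      (CliffordAlgebra.ι (Qq n) y * CliffordAlgebra.ι (Qq n) x) = 0 := by
    rw [mul_assoc, ← mul_assoc (CliffordAlgebra.ι (Qq n) y), cl_ι_sq hy, zero_mul, mul_zero]
  simp only [twoPlaneElt, add_mul, mul_add, smul_mul_smul_comm, h1, smul_zero, one_mul, mul_one,
    add_zero]
  rw [cl_ι_mul_comm x y, smul_sub, smul_smul]
  have : (1 : Cl n) = (r * r + r * s * (2 * Bform n x y)) • 1 := by rw [hr, one_smul]
  conv_rhs => rw [this]
  module

theorem bform_comm {n : ℕ} (x y : V n) : Bform n x y = Bform n y x := by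
  simp [Bform, add_comm]

theorem twoPlaneElt_conj {n : ℕ} {r s a b : ℂ} {x y : V n} (hx : Bform n x x = 0)
    (hy : Bform n y y = 0) (hr : r * r + r * s * (2 * Bform n x y) = 1)
    (ha : a = s * (r + s * (2 * Bform n x y))) (hb : b = -(s * r)) (z : V n) :
    CliffordAlgebra.ι (Qq n) (twoPlaneMap a b x y z) =
      twoPlaneElt r s x y * CliffordAlgebra.ι (Qq n) z * twoPlaneElt r s y x := by
  have hz : twoPlaneElt r s x y * CliffordAlgebra.ι (Qq n) z =
      CliffordAlgebra.ι (Qq n) z * twoPlaneElt r s x y +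
        (s * (2 * Bform n y z)) • CliffordAlgebra.ι (Qq n) x -
        (s * (2 * Bform n x z)) • CliffordAlgebra.ι (Qq n) y := by
    have e1 : CliffordAlgebra.ι (Qq n) x * CliffordAlgebra.ι (Qq n) y *
        CliffordAlgebra.ι (Qq n) z = (2 * Bform n y z) • CliffordAlgebra.ι (Qq n) x -
          (2 * Bform n x z) • CliffordAlgebra.ι (Qq n) y +
          CliffordAlgebra.ι (Qq n) z *
            (CliffordAlgebra.ι (Qq n) x * CliffordAlgebra.ι (Qq n) y) := by
      rw [← mul_assoc (CliffordAlgebra.ι (Qq n) z), cl_ι_mul_comm x z, mul_assoc, sub_mul,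
        mul_assoc, cl_ι_mul_comm y z, mul_sub]
      simp only [mul_smul_comm, smul_mul_assoc, mul_one, one_mul]
      abel
    simp only [twoPlaneElt, add_mul, mul_add, smul_mul_assoc, mul_smul_comm, one_mul, mul_one, e1]
    module
  have e2 : CliffordAlgebra.ι (Qq n) x * twoPlaneElt r s y x =
      (r + s * (2 * Bform n x y)) • CliffordAlgebra.ι (Qq n) x := by
    simp only [twoPlaneElt, mul_add, mul_smul_comm, mul_one]
    rw [cl_ι_mul_comm x y, mul_sub, ← mul_assoc, cl_ι_sq hx, zero_mul, sub_zero, mul_smul_comm,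
      mul_one]
    module
  have e3 : CliffordAlgebra.ι (Qq n) y * twoPlaneElt r s y x =
      r • CliffordAlgebra.ι (Qq n) y := by
    simp only [twoPlaneElt, mul_add, mul_smul_comm, mul_one]
    rw [← mul_assoc, cl_ι_sq hy, zero_mul, smul_zero, add_zero]
  rw [hz, sub_mul, add_mul, mul_assoc, twoPlaneElt_mul_swap hy hr, mul_one, smul_mul_assoc,
    smul_mul_assoc, e2, e3, twoPlaneMap_apply, ha, hb]
  simp only [map_add, map_smul]
  module

theorem spinG_twoPlaneElt {n : ℕ} {r s : ℂ} {x y : V n} (hx : Bform n x x = 0)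
    (hy : Bform n y y = 0) (hr : r * r + r * s * (2 * Bform n x y) = 1) :
    SpinG (twoPlaneElt r s x y) := by
  have h1 := twoPlaneElt_mul_swap hy hr
  have h2 : twoPlaneElt r s y x * twoPlaneElt r s x y = 1 :=
    twoPlaneElt_mul_swap hx (by rw [bform_comm y x, hr])
  refine ⟨⟨⟨⟨_, _, h1, h2⟩, rfl⟩, ?_, fun v => ?_⟩, ?_⟩
  · rw [conjC_twoPlaneElt, h1]
  · exact ⟨_, by
      rw [conjC_twoPlaneElt, involute_twoPlaneElt, ← twoPlaneElt_conj hx hy hr rfl rfl v]⟩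
  · refine Submodule.add_mem _ (Submodule.smul_mem _ _ ?_) (Submodule.smul_mem _ _ ?_)
    · exact Submodule.one_le.1 (CliffordAlgebra.one_le_evenOdd_zero _)
    · exact CliffordAlgebra.ι_mul_ι_mem_evenOdd_zero _ _ _

theorem map_mem_exteriorPower {n : ℕ} (T : V n →ₗ[ℂ] V n) (k : ℕ) :
    ∀ y ∈ ⋀[ℂ]^k (V n), ExteriorAlgebra.map T y ∈ ⋀[ℂ]^k (V n) := by
  intro y hy
  have h : (⋀[ℂ]^k (V n)).map (ExteriorAlgebra.map T).toLinearMap ≤ ⋀[ℂ]^k (V n) := by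
    rw [ExteriorAlgebra.exteriorPower, Submodule.map_pow]
    refine pow_le_pow_left' ?_ k
    rw [ExteriorAlgebra.ι_range_map_map]
    exact Submodule.map_le_iff_le_comap.2 (by rintro _ ⟨w, rfl⟩; exact ⟨T w, rfl⟩)
  exact h (Submodule.mem_map_of_mem hy)

/-- `Spin(Q)`-equivariance of a map `Λ^{n+1} ℂ^{2n} → S ⊗ S`. -/
def IsSpinEquivariant {n : ℕ}
    (p : ↥(⋀[ℂ]^(n + 1) (V n)) →ₗ[ℂ] TensorProduct ℂ (SS n) (SS n)) : Prop :=
  ∀ g : Cl n, SpinG g → ∀ T : V n →ₗ[ℂ] V n,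
    (∀ x : V n, CliffordAlgebra.ι (Qq n) (T x) =
      CliffordAlgebra.involute g * CliffordAlgebra.ι (Qq n) x * conjC g) →
    ∀ hT : ∀ y ∈ ⋀[ℂ]^(n + 1) (V n),
      ExteriorAlgebra.map T y ∈ ⋀[ℂ]^(n + 1) (V n),
    ∀ ω : ↥(⋀[ℂ]^(n + 1) (V n)),
      p ((ExteriorAlgebra.map T).toLinearMap.restrict hT ω) =
        TensorProduct.map (Gamma n g) (Gamma n g) (p ω)

theorem IsSpinEquivariant.twoPlane {n : ℕ}
    {p : ↥(⋀[ℂ]^(n + 1) (V n)) →ₗ[ℂ] TensorProduct ℂ (SS n) (SS n)} (hp : IsSpinEquivariant p)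
    {r s a b : ℂ} {x y : V n} (hx : Bform n x x = 0)
    (hy : Bform n y y = 0) (hr : r * r + r * s * (2 * Bform n x y) = 1)
    (ha : a = s * (r + s * (2 * Bform n x y))) (hb : b = -(s * r))
    {ω ω' : ↥(⋀[ℂ]^(n + 1) (V n))}
    (hω : (ω' : ExteriorAlgebra ℂ (V n)) = ExteriorAlgebra.map (twoPlaneMap a b x y) ω) :
    p ω' = TensorProduct.map (Gamma n (twoPlaneElt r s x y)) (Gamma n (twoPlaneElt r s x y))
      (p ω) := by
  rw [← hp _ (spinG_twoPlaneElt hx hy hr) (twoPlaneMap a b x y) (fun z => by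
    rw [conjC_twoPlaneElt, involute_twoPlaneElt, twoPlaneElt_conj hx hy hr ha hb])
    (map_mem_exteriorPower _ _)]
  congr 1
  exact Subtype.ext hω

/-! ### The spin representation on wedge monomials -/

theorem eS_eq_wedgeProd {n : ℕ} (J : Finset (Fin n)) :
    eS J = wedgeProd (fun i => (Pi.single i 1 : Fin n → ℂ)) J := rfl

/-- Interior product with `e_i^∨` on `Λ^• W`. -/
def intProd {n : ℕ} (i : Fin n) : SS n →ₗ[ℂ] SS n :=
  CliffordAlgebra.contractLeft (Q := (0 : QuadraticForm ℂ (Fin n → ℂ)))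
    (dualL n (Pi.single i 1))

theorem intProd_ι_mul {n : ℕ} (i j : Fin n) (x : SS n) :
    intProd i (ExteriorAlgebra.ι ℂ (Pi.single j 1) * x) =
      (if i = j then (1 : ℂ) else 0) • x -
        ExteriorAlgebra.ι ℂ (Pi.single j 1) * intProd i x := by
  have h : dualL n (Pi.single i 1) (Pi.single j 1) = if i = j then (1 : ℂ) else 0 := by
    simp [dualL, Pi.single_apply, eq_comm]
  rw [← h]
  exact CliffordAlgebra.contractLeft_ι_mul _ _ _

theorem intProd_one {n : ℕ} (i : Fin n) : intProd i (1 : SS n) = 0 :=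
  CliffordAlgebra.contractLeft_one (Q := (0 : QuadraticForm ℂ (Fin n → ℂ))) _

theorem intProd_intProd_swap {n : ℕ} (i j : Fin n) (x : SS n) :
    intProd i (intProd j x) = -intProd j (intProd i x) :=
  CliffordAlgebra.contractLeft_comm _ _ _

theorem intProd_list_prod {n : ℕ} {i : Fin n} {l : List (Fin n)} (hi : i ∉ l) :
    intProd i
      (l.map fun k => ExteriorAlgebra.ι ℂ (Pi.single k 1 : Fin n → ℂ)).prod = 0 := by
  induction l with
  | nil => simpa using intProd_one i
  | cons b l ih =>
    rw [List.mem_cons, not_or] at hi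
    rw [List.map_cons, List.prod_cons, intProd_ι_mul, ih hi.2, if_neg hi.1]
    simp

theorem intProd_eS {n : ℕ} {i : Fin n} {J : Finset (Fin n)} (hi : i ∉ J) :
    intProd i (eS J) = 0 :=
  intProd_list_prod (by simpa using hi)

theorem gamGen_eW {n : ℕ} (i : Fin n) (x : SS n) :
    gamGen n (eW n i) x = ExteriorAlgebra.ι ℂ (Pi.single i 1) * x := by
  simp [gamGen, eW]

theorem gamGen_eD {n : ℕ} (i : Fin n) (x : SS n) : gamGen n (eD n i) x = intProd i x := by
  simp [gamGen, eD, intProd]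

theorem Gamma_twoPlaneElt {n : ℕ} (r s : ℂ) (x y : V n) (φ : SS n) :
    Gamma n (twoPlaneElt r s x y) φ = r • φ + s • gamGen n x (gamGen n y φ) := by
  simp [Gamma, twoPlaneElt]

/-! ### Weights -/

theorem Gamma_torus {n : ℕ} (i : Fin n) (φ : SS n) :
    Gamma n (twoPlaneElt (1 / 2) (3 / 2) (eW n i) (eD n i)) φ =
      (1 / 2 : ℂ) • φ + (3 / 2 : ℂ) • (ExteriorAlgebra.ι ℂ (Pi.single i 1) * intProd i φ) := by
  rw [Gamma_twoPlaneElt, gamGen_eW, gamGen_eD]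

theorem Gamma_torus_eS {n : ℕ} (i : Fin n) (J : Finset (Fin n)) :
    Gamma n (twoPlaneElt (1 / 2) (3 / 2) (eW n i) (eD n i)) (eS J) =
      (if i ∈ J then 2 else 1 / 2 : ℂ) • eS J := by
  rw [Gamma_torus]
  by_cases h : i ∈ J
  · have h0 : ExteriorAlgebra.ι ℂ (Pi.single i 1) * eS J = 0 :=
      ι_mul_wedgeProd_of_mem (fun i => (Pi.single i 1 : Fin n → ℂ)) h
    have h1 := intProd_ι_mul i i (eS J)
    rw [h0, map_zero, if_pos rfl, one_smul, eq_comm, sub_eq_zero] at h1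
    rw [← h1, if_pos h]
    module
  · rw [intProd_eS h, if_neg h, mul_zero, smul_zero, add_zero]

/-- Iterated intProd product by the `e_i^∨`, `i ∈ l`, followed by the scalar part. -/
def listCoeff {n : ℕ} : List (Fin n) → (SS n →ₗ[ℂ] ℂ)
  | [] => (ExteriorAlgebra.algebraMapInv (R := ℂ) (M := Fin n → ℂ)).toLinearMap
  | i :: l => (listCoeff l).comp (intProd i)

theorem listCoeff_torus {n : ℕ} (i : Fin n) (l : List (Fin n)) (φ : SS n) :
    listCoeff l (Gamma n (twoPlaneElt (1 / 2) (3 / 2) (eW n i) (eD n i)) φ) =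
      (if i ∈ l then 2 else 1 / 2) * listCoeff l φ := by
  induction l generalizing φ with
  | nil =>
    rw [Gamma_torus]
    simp [listCoeff, ExteriorAlgebra.algebraMapInv]
  | cons j l ih =>
    simp only [listCoeff, LinearMap.comp_apply]
    by_cases h : j = i
    · subst h
      have h0 : intProd j (intProd j φ) = 0 := CliffordAlgebra.contractLeft_contractLeft _ _
      have : intProd j (Gamma n (twoPlaneElt (1 / 2) (3 / 2) (eW n j) (eD n j)) φ) =
          (2 : ℂ) • intProd j φ := by
        rw [Gamma_torus, map_add, map_smul, map_smul, intProd_ι_mul, h0, if_pos rfl]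
        simp only [mul_zero, sub_zero]
        module
      rw [this, map_smul, if_pos List.mem_cons_self, smul_eq_mul]
    · have : intProd j (Gamma n (twoPlaneElt (1 / 2) (3 / 2) (eW n i) (eD n i)) φ) =
          Gamma n (twoPlaneElt (1 / 2) (3 / 2) (eW n i) (eD n i)) (intProd j φ) := by
        rw [Gamma_torus, Gamma_torus, map_add, map_smul, map_smul, intProd_ι_mul, if_neg h,
          intProd_intProd_swap j i]
        simp
      rw [this, ih]
      simp [Ne.symm h]

/-- The coefficient of `e_J` in an element of `Λ^• W`. -/
def eSCoeff {n : ℕ} (J : Finset (Fin n)) : SS n →ₗ[ℂ] ℂ := listCoeff (J.sort (· ≤ ·))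

theorem eSCoeff_torus {n : ℕ} (i : Fin n) (J : Finset (Fin n)) (φ : SS n) :
    eSCoeff J (Gamma n (twoPlaneElt (1 / 2) (3 / 2) (eW n i) (eD n i)) φ) =
      (if i ∈ J then 2 else 1 / 2) * eSCoeff J φ := by
  simpa [eSCoeff] using listCoeff_torus i (J.sort (· ≤ ·)) φ

theorem eSCoeff_eS_self {n : ℕ} (J : Finset (Fin n)) : eSCoeff J (eS J) = 1 := by
  have key : ∀ l : List (Fin n), l.Nodup →
      listCoeff l (l.map fun k => ExteriorAlgebra.ι ℂ (Pi.single k 1 : Fin n → ℂ)).prod = 1 := by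
    intro l hl
    induction l with
    | nil => simp [listCoeff]
    | cons b l ih =>
      rw [List.nodup_cons] at hl
      rw [listCoeff, LinearMap.comp_apply, List.map_cons, List.prod_cons, intProd_ι_mul,
        intProd_list_prod hl.1, if_pos rfl, mul_zero, sub_zero, one_smul, ih hl.2]
  exact key _ (Finset.sort_nodup _ _)

theorem eSCoeff_eS_of_ne {n : ℕ} {J K : Finset (Fin n)} (h : J ≠ K) : eSCoeff J (eS K) = 0 := by
  by_contra h0
  refine h (Finset.ext fun i => ?_)
  have h1 := eSCoeff_torus i J (eS K)
  rw [Gamma_torus_eS, map_smul, smul_eq_mul] at h1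
  have h2 := mul_right_cancel₀ h0 h1
  split_ifs at h2 <;> first | tauto | (norm_num at h2)

theorem eSCoeff_sum {n : ℕ} (s : Finset (Finset (Fin n))) (f : Finset (Fin n) → ℂ)
    {J : Finset (Fin n)} (hJ : J ∈ s) :
    eSCoeff J (∑ K ∈ s, f K • (sgn4 K • eS K)) = f J * sgn4 J := by
  rw [map_sum, Finset.sum_eq_single_of_mem J hJ]
  · simp [eSCoeff_eS_self]
  · intro K _ hK
    simp [eSCoeff_eS_of_ne hK.symm]

theorem two_bform_eD_eW {n : ℕ} (i j : Fin n) :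
    2 * Bform n (eD n i) (eW n j) = if j = i then 1 else 0 := by
  simp [Bform, eD, eW, Pi.single_apply]

theorem two_bform_eW_eD {n : ℕ} (i j : Fin n) :
    2 * Bform n (eW n i) (eD n j) = if j = i then 1 else 0 := by
  rw [bform_comm, two_bform_eD_eW]
  simp [eq_comm]

theorem bform_eW_eW {n : ℕ} (i j : Fin n) : Bform n (eW n i) (eW n j) = 0 := by
  simp [Bform, eW]

theorem bform_eD_eD {n : ℕ} (i j : Fin n) : Bform n (eD n i) (eD n j) = 0 := by
  simp [Bform, eD]

theorem mul_bform_eq {n : ℕ} (a : ℂ) (x y : V n) :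
    2 * a * Bform n x y = a * (2 * Bform n x y) := by ring

theorem map_torus_eII {n : ℕ} (i : Fin n) {K Kd : Finset (Fin n)}
    (h : K.card + Kd.card = n + 1) :
    ExteriorAlgebra.map (twoPlaneMap 3 (-(3 / 4)) (eW n i) (eD n i))
        (eII K Kd : ExteriorAlgebra ℂ (V n)) =
      ((if i ∈ K then 4 else 1) * (if i ∈ Kd then 1 / 4 else 1) : ℂ) •
        (eII K Kd : ExteriorAlgebra ℂ (V n)) := by
  have hW : ∀ k, twoPlaneMap 3 (-(3 / 4)) (eW n i) (eD n i) (eW n k) =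
      (if k = i then 4 else 1 : ℂ) • eW n k := by
    intro k
    rw [twoPlaneMap_apply, mul_bform_eq, mul_bform_eq, two_bform_eD_eW, bform_eW_eW]
    split_ifs with hk
    · subst hk
      module
    · module
  have hD : ∀ k, twoPlaneMap 3 (-(3 / 4)) (eW n i) (eD n i) (eD n k) =
      (if k = i then 1 / 4 else 1 : ℂ) • eD n k := by
    intro k
    rw [twoPlaneMap_apply, mul_bform_eq, mul_bform_eq, two_bform_eW_eD, bform_eD_eD]
    split_ifs with hk
    · subst hk
      module
    · module
  rw [coe_eII h, map_mul, map_wedgeProd, map_wedgeProd]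
  simp only [hW, hD, wedgeProd_smul, Finset.prod_ite_eq', smul_mul_smul_comm]

theorem IsSpinEquivariant.eSCoeff_eq_zero_or_weight {n : ℕ}
    {p : ↥(⋀[ℂ]^(n + 1) (V n)) →ₗ[ℂ] TensorProduct ℂ (SS n) (SS n)} (hp : IsSpinEquivariant p)
    {K Kd : Finset (Fin n)} (h : K.card + Kd.card = n + 1) (J J' : Finset (Fin n)) (i : Fin n) :
    LinearMap.mul' ℂ ℂ (TensorProduct.map (eSCoeff J) (eSCoeff J') (p (eII K Kd))) = 0 ∨
      ((if i ∈ K then 4 else 1) * (if i ∈ Kd then 1 / 4 else 1) : ℂ) =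
        (if i ∈ J then 2 else 1 / 2) * (if i ∈ J' then 2 else 1 / 2) := by
  set Φ : TensorProduct ℂ (SS n) (SS n) →ₗ[ℂ] ℂ :=
    (LinearMap.mul' ℂ ℂ).comp (TensorProduct.map (eSCoeff J) (eSCoeff J')) with hΦ
  set μ : ℂ := (if i ∈ K then 4 else 1) * (if i ∈ Kd then 1 / 4 else 1)
  set lam : ℂ := (if i ∈ J then 2 else 1 / 2) * (if i ∈ J' then 2 else 1 / 2)
  set g := Gamma n (twoPlaneElt (1 / 2) (3 / 2) (eW n i) (eD n i)) with hg
  have h1 : p (μ • eII K Kd) = TensorProduct.map g g (p (eII K Kd)) := by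
    refine hp.twoPlane (a := 3) (b := -(3 / 4)) (bform_eW_eW i i) (bform_eD_eD i i) ?_ ?_
      (by norm_num) (map_torus_eII i h).symm <;> rw [two_bform_eW_eD, if_pos rfl] <;> norm_num
  have h2 : ∀ t, Φ (TensorProduct.map g g t) = lam * Φ t := by
    intro t
    induction t with
    | zero => simp
    | add a b ha hb => rw [map_add, map_add, ha, hb, map_add, mul_add]
    | tmul a b =>
      simp only [hΦ, LinearMap.comp_apply, TensorProduct.map_tmul, LinearMap.mul'_apply]
      rw [hg, eSCoeff_torus, eSCoeff_torus]
      ring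
  have h3 : μ * Φ (p (eII K Kd)) = lam * Φ (p (eII K Kd)) := by
    rw [← h2, ← h1, map_smul, map_smul, smul_eq_mul]
  by_cases h0 : Φ (p (eII K Kd)) = 0
  · exact Or.inl h0
  · exact Or.inr (mul_right_cancel₀ h0 h3)

/-! ### The values of an equivariant map on the relevant weight vectors -/

theorem wedgeProd_mul_ι_mul_map_wedgeProd {n : ℕ} {T : V n →ₗ[ℂ] V n} {i j : Fin n}
    {I L : Finset (Fin n)} (hi : i ∈ I) (hj : j ∈ L)
    (hTj : T (eD n j) = eD n j - eW n i) (hT : ∀ k ∈ L, k ≠ j → T (eD n k) = eD n k) (w : V n) :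
    wedgeProd (eW n) I * (ExteriorAlgebra.ι ℂ w * ExteriorAlgebra.map T (wedgeProd (eD n) L)) =
      wedgeProd (eW n) I * (ExteriorAlgebra.ι ℂ w * wedgeProd (eD n) L) := by
  have hL : ExteriorAlgebra.map T (wedgeProd (eD n) (L.erase j)) =
      wedgeProd (eD n) (L.erase j) := by
    rw [map_wedgeProd]
    exact wedgeProd_congr fun k hk =>
      hT k (Finset.mem_of_mem_erase hk) (Finset.ne_of_mem_erase hk)
  have h0 : wedgeProd (eW n) I * (ExteriorAlgebra.ι ℂ w *
      (ExteriorAlgebra.ι ℂ (eW n i) * wedgeProd (eD n) (L.erase j))) = 0 := by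
    rw [← mul_assoc (ExteriorAlgebra.ι ℂ w), exteriorAlgebra_ι_mul_swap w, neg_mul, mul_neg,
      mul_assoc, ← mul_assoc, wedgeProd_mul_ι_of_mem _ hi, zero_mul, neg_zero]
  rw [wedgeProd_eq_ι_mul_erase _ hj, map_smul, map_mul, ExteriorAlgebra.map_apply_ι, hL, hTj,
    map_sub, sub_mul]
  simp only [mul_smul_comm, mul_sub, h0, sub_zero]

theorem map_raise_eII {n : ℕ} {i j : Fin n} {I Id : Finset (Fin n)} (hi : i ∈ I) (hj : j ∉ I)
    (hid : i ∈ Id) (hjd : j ∈ Id) (h : I.card + Id.card = n + 1) :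
    ExteriorAlgebra.map (twoPlaneMap 1 (-1) (eW n j) (eW n i))
        (eII I Id : ExteriorAlgebra ℂ (V n)) =
      eII I Id + (-1 : ℂ) ^ (numBelow i Id + I.card + numBelow j I) •
        (eII (insert j I) (Id.erase i) : ExteriorAlgebra ℂ (V n)) := by
  have hij : i ≠ j := fun e => hj (e ▸ hi)
  set T := twoPlaneMap 1 (-1) (eW n j) (eW n i) with hT
  have hD : ∀ k, T (eD n k) = eD n k + (if k = i then 1 else 0 : ℂ) • eW n j -
      (if k = j then 1 else 0 : ℂ) • eW n i := by
    intro k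
    rw [hT, twoPlaneMap_apply, mul_bform_eq, mul_bform_eq, two_bform_eW_eD, two_bform_eW_eD]
    module
  have hW : ∀ k, T (eW n k) = eW n k := by
    intro k
    simp [hT, twoPlaneMap_apply, bform_eW_eW]
  have hjd' : j ∈ Id.erase i := Finset.mem_erase.2 ⟨hij.symm, hjd⟩
  have hcard : (insert j I).card + (Id.erase i).card = n + 1 := by
    rw [Finset.card_insert_of_notMem hj, Finset.card_erase_of_mem hid]
    have := Finset.card_pos.2 ⟨i, hid⟩
    omega
  have hTj : T (eD n j) = eD n j - eW n i := by simp [hD, hij.symm]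
  have hTi : T (eD n i) = eD n i + eW n j := by simp [hD, hij]
  have hTk : ∀ k ∈ Id.erase i, k ≠ j → T (eD n k) = eD n k := by
    intro k hk hkj
    simp [hD, hkj, Finset.ne_of_mem_erase hk]
  have hI : ExteriorAlgebra.map T (wedgeProd (eW n) I) = wedgeProd (eW n) I := by
    simp only [map_wedgeProd, hW]
  have hraise : wedgeProd (eW n) I * ExteriorAlgebra.ι ℂ (eW n j) =
      (-1 : ℂ) ^ (I.card + numBelow j I) • wedgeProd (eW n) (insert j I) := by
    rw [wedgeProd_mul_ι, ι_mul_wedgeProd _ hj, smul_smul, pow_add]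
  rw [coe_eII h, coe_eII hcard, map_mul, hI, wedgeProd_eq_ι_mul_erase (eD n) hid, map_smul,
    map_mul, ExteriorAlgebra.map_apply_ι, mul_smul_comm,
    wedgeProd_mul_ι_mul_map_wedgeProd hi hjd' hTj hTk, hTi, map_add, add_mul, mul_add,
    ← mul_assoc _ (ExteriorAlgebra.ι ℂ (eW n j)), hraise, smul_add, mul_smul_comm,
    smul_mul_assoc, smul_smul, ← pow_add, add_assoc]

theorem map_shift_eII {n : ℕ} {i j : Fin n} (hij : i ≠ j) :
    ExteriorAlgebra.map (twoPlaneMap 1 (-1) (eW n i) (eD n j))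
        (eII {j} Finset.univ : ExteriorAlgebra ℂ (V n)) =
      eII {j} Finset.univ + (eII {i} Finset.univ : ExteriorAlgebra ℂ (V n)) := by
  have hc : ∀ k : Fin n, ({k} : Finset (Fin n)).card + (Finset.univ : Finset (Fin n)).card =
      n + 1 := by
    intro k
    simp [add_comm]
  set T := twoPlaneMap 1 (-1) (eW n i) (eD n j) with hT
  have hD : ∀ k, T (eD n k) = eD n k - (if k = i then 1 else 0 : ℂ) • eD n j := by
    intro k
    rw [hT, twoPlaneMap_apply, mul_bform_eq, mul_bform_eq, two_bform_eW_eD, bform_eD_eD]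
    module
  have hW : T (eW n j) = eW n j + eW n i := by
    rw [hT, twoPlaneMap_apply, mul_bform_eq, mul_bform_eq, two_bform_eD_eW, bform_eW_eW]
    simp
  have hDuniv : ExteriorAlgebra.map T (wedgeProd (eD n) Finset.univ) =
      wedgeProd (eD n) Finset.univ := by
    have he : ExteriorAlgebra.map T (wedgeProd (eD n) (Finset.univ.erase i)) =
        wedgeProd (eD n) (Finset.univ.erase i) := by
      rw [map_wedgeProd]
      exact wedgeProd_congr fun k hk => by simp [hD, Finset.ne_of_mem_erase hk]
    have h0 : ExteriorAlgebra.ι ℂ (eD n j) * wedgeProd (eD n) (Finset.univ.erase i) = 0 :=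
      ι_mul_wedgeProd_of_mem _ (Finset.mem_erase.2 ⟨hij.symm, Finset.mem_univ j⟩)
    rw [wedgeProd_eq_ι_mul_erase (eD n) (Finset.mem_univ i), map_smul, map_mul,
      ExteriorAlgebra.map_apply_ι, he, hD, if_pos rfl, one_smul, map_sub, sub_mul, h0, sub_zero]
  have hs : ∀ k : Fin n, wedgeProd (eW n) {k} = ExteriorAlgebra.ι ℂ (eW n k) := by
    intro k
    simp [wedgeProd]
  rw [coe_eII (hc i), coe_eII (hc j), map_mul, hDuniv, hs, hs, ExteriorAlgebra.map_apply_ι, hW,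
    map_add, add_mul]

/-- The tensor `e_I ⊗ e_{I∖i}` or `e_{I∖i} ⊗ e_I`, whichever lies in `S₊ ⊗ S₋`. -/
def cartanTensor {n : ℕ} (I : Finset (Fin n)) (i : Fin n) : TensorProduct ℂ (SS n) (SS n) :=
  if Even I.card then eS I ⊗ₜ[ℂ] eS (I.erase i) else eS (I.erase i) ⊗ₜ[ℂ] eS I

theorem Gamma_raise_cartanTensor {n : ℕ} {i j : Fin n} {I : Finset (Fin n)} (hi : i ∈ I)
    (hj : j ∉ I) :
    TensorProduct.map (Gamma n (twoPlaneElt 1 1 (eW n j) (eW n i)))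
        (Gamma n (twoPlaneElt 1 1 (eW n j) (eW n i))) (cartanTensor I i) =
      cartanTensor I i + (-1 : ℂ) ^ (numBelow i I + numBelow j I) •
        cartanTensor (insert j I) j := by
  set g := Gamma n (twoPlaneElt 1 1 (eW n j) (eW n i)) with hg
  have h1 : g (eS I) = eS I := by
    have h0 : ExteriorAlgebra.ι ℂ (Pi.single i 1) * eS I = 0 :=
      ι_mul_wedgeProd_of_mem (fun i => (Pi.single i 1 : Fin n → ℂ)) hi
    rw [hg, Gamma_twoPlaneElt, gamGen_eW, gamGen_eW, h0]
    simp
  have h2 : g (eS (I.erase i)) = eS (I.erase i) +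
      (-1 : ℂ) ^ (numBelow i I + numBelow j I) • eS (insert j I) := by
    have e1 : ExteriorAlgebra.ι ℂ (Pi.single i 1) * eS (I.erase i) =
        (-1 : ℂ) ^ numBelow i I • eS I := by
      rw [eS_eq_wedgeProd, ι_mul_wedgeProd (fun i => (Pi.single i 1 : Fin n → ℂ))
        (Finset.notMem_erase i I), Finset.insert_erase hi, numBelow_erase, eS_eq_wedgeProd]
    have e2 : ExteriorAlgebra.ι ℂ (Pi.single j 1) * eS I =
        (-1 : ℂ) ^ numBelow j I • eS (insert j I) :=
      ι_mul_wedgeProd (fun i => (Pi.single i 1 : Fin n → ℂ)) hj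
    rw [hg, Gamma_twoPlaneElt, gamGen_eW, gamGen_eW, e1, mul_smul_comm, e2, one_smul, one_smul,
      smul_smul, pow_add]
  unfold cartanTensor
  rw [Finset.card_insert_of_notMem hj, Finset.erase_insert hj]
  by_cases he : Even I.card
  · rw [if_pos he, if_neg (by simpa [Nat.even_add_one] using he), TensorProduct.map_tmul, h1, h2,
      TensorProduct.tmul_add, TensorProduct.tmul_smul]
  · rw [if_neg he, if_pos (Nat.even_add_one.2 he), TensorProduct.map_tmul, h1, h2,
      TensorProduct.add_tmul, TensorProduct.smul_tmul']

theorem numBelow_add_numBelow_compl_erase {n : ℕ} (i : Fin n) (I : Finset (Fin n)) :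
    numBelow i (I.erase i)ᶜ + numBelow i I = i := by
  rw [← numBelow_erase i I, numBelow, numBelow, ← Finset.card_union_of_disjoint]
  · rw [← Finset.filter_union, Finset.union_comm, Finset.union_compl]
    have : (Finset.univ.filter fun k : Fin n => k < i) = Finset.Iio i := by
      ext k
      simp
    rw [this, Fin.card_Iio]
  · exact Finset.disjoint_filter_filter disjoint_compl_left

theorem IsSpinEquivariant.apply_eII {n : ℕ} (hn : 0 < n)
    {p : ↥(⋀[ℂ]^(n + 1) (V n)) →ₗ[ℂ] TensorProduct ℂ (SS n) (SS n)} (hp : IsSpinEquivariant p)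
    (hnorm : p (eII {⟨0, hn⟩} Finset.univ) =
      ((-1 : ℂ) ^ (n * (n - 1) / 2)) •
        ((1 : SS n) ⊗ₜ[ℂ] ExteriorAlgebra.ι ℂ (Pi.single (⟨0, hn⟩ : Fin n) 1)))
    {I : Finset (Fin n)} {i : Fin n} (hi : i ∈ I) :
    p (eII I (I.erase i)ᶜ) =
      (-1 : ℂ) ^ ((∑ j ∈ (I.erase i)ᶜ, (j : ℕ)) + I.card.choose 2) • cartanTensor I i := by
  have hsum : ∑ j : Fin n, (j : ℕ) = n * (n - 1) / 2 := by
    rw [Fin.sum_univ_eq_sum_range (fun k => k), Finset.sum_range_id]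
  have hsingle : ∀ k : Fin n, cartanTensor {k} k =
      (1 : SS n) ⊗ₜ[ℂ] ExteriorAlgebra.ι ℂ (Pi.single k 1) := by
    intro k
    simp [cartanTensor, eS]
  induction hm : I.card generalizing I i with
  | zero =>
    rw [Finset.card_eq_zero] at hm
    simp [hm] at hi
  | succ m ih =>
    rcases Nat.eq_zero_or_pos m with rfl | hmpos
    · obtain ⟨k, rfl⟩ := Finset.card_eq_one.1 hm
      obtain rfl := Finset.mem_singleton.1 hi
      have hemp : ({i} : Finset (Fin n)).erase i = ∅ := by simp
      rw [hemp, Finset.compl_empty, hsum, hsingle]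
      by_cases h0 : i = ⟨0, hn⟩
      · subst h0
        simpa using hnorm
      · have hQ : Bform n (eW n i) (eD n ⟨0, hn⟩) = 0 := by
          have := two_bform_eW_eD i (⟨0, hn⟩ : Fin n)
          rw [if_neg (Ne.symm h0)] at this
          simpa using this
        have key := hp.twoPlane (r := 1) (s := 1) (a := 1) (b := -1) (bform_eW_eW i i)
          (bform_eD_eD (⟨0, hn⟩ : Fin n) ⟨0, hn⟩)
          (by rw [hQ]; norm_num) (by rw [hQ]; norm_num) (by norm_num)
          (ω := eII {⟨0, hn⟩} Finset.univ) (ω' := eII {⟨0, hn⟩} Finset.univ + eII {i} Finset.univ)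
          (map_shift_eII h0).symm
        have hone : Gamma n (twoPlaneElt 1 1 (eW n i) (eD n ⟨0, hn⟩)) 1 = 1 := by
          rw [Gamma_twoPlaneElt, gamGen_eD, intProd_one]
          simp
        have hvec : Gamma n (twoPlaneElt 1 1 (eW n i) (eD n ⟨0, hn⟩))
            (ExteriorAlgebra.ι ℂ (Pi.single (⟨0, hn⟩ : Fin n) 1)) =
            ExteriorAlgebra.ι ℂ (Pi.single (⟨0, hn⟩ : Fin n) 1) +
              ExteriorAlgebra.ι ℂ (Pi.single i 1) := by
          have := intProd_ι_mul (⟨0, hn⟩ : Fin n) ⟨0, hn⟩ (1 : SS n)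
          rw [mul_one, intProd_one, mul_zero, sub_zero, if_pos rfl, one_smul] at this
          rw [Gamma_twoPlaneElt, gamGen_eD, gamGen_eW, this]
          simp
        rw [map_add, hnorm, map_smul, TensorProduct.map_tmul, hone, hvec, TensorProduct.tmul_add,
          smul_add] at key
        simpa using add_left_cancel key
    · have hcard : (I.erase i).card = m := by
        rw [Finset.card_erase_of_mem hi, hm, Nat.add_sub_cancel]
      obtain ⟨k, hk⟩ := Finset.card_pos.1 (hcard.symm ▸ hmpos)
      set L := I.erase i with hL
      have hiL : i ∉ L := Finset.notMem_erase i I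
      have hIL : insert i L = I := Finset.insert_erase hi
      have hid : i ∈ (L.erase k)ᶜ := by
        rw [Finset.mem_compl]
        exact fun h => hiL (Finset.mem_of_mem_erase h)
      have hkd : k ∈ (L.erase k)ᶜ := by simp
      have herase : (L.erase k)ᶜ.erase k = Lᶜ := by
        ext a
        simp only [Finset.mem_erase, Finset.mem_compl]
        by_cases hak : a = k
        · simp [hak, hk]
        · simp [hak]
      have hcardL : L.card + (L.erase k)ᶜ.card = n + 1 := by
        have := Finset.card_pos.2 ⟨k, hk⟩
        have hle := Finset.card_le_univ L
        rw [Finset.card_compl, Finset.card_erase_of_mem hk]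
        rw [Fintype.card_fin] at hle ⊢
        omega
      have hmap := map_raise_eII hk hiL hkd hid hcardL
      rw [herase, hIL] at hmap
      have key := hp.twoPlane (r := 1) (s := 1) (a := 1) (b := -1) (bform_eW_eW i i)
          (bform_eW_eW k k)
          (by rw [bform_eW_eW]; norm_num) (by rw [bform_eW_eW]; norm_num) (by norm_num)
          (ω := eII L (L.erase k)ᶜ)
          (ω' := eII L (L.erase k)ᶜ +
            (-1 : ℂ) ^ (numBelow k (L.erase k)ᶜ + L.card + numBelow i L) • eII I Lᶜ)
          hmap.symm
      rw [map_add, ih hk hcard, map_smul, map_smul, Gamma_raise_cartanTensor hk hiL, smul_add,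
        hIL] at key
      have key' := congrArg
        (fun t => (-1 : ℂ) ^ (numBelow k (L.erase k)ᶜ + L.card + numBelow i L) • t)
        (add_left_cancel key)
      simp only [smul_smul, ← pow_add] at key'
      rw [(Even.neg_one_pow ⟨_, rfl⟩ : (-1 : ℂ) ^ (numBelow k (L.erase k)ᶜ + L.card +
        numBelow i L + (numBelow k (L.erase k)ᶜ + L.card + numBelow i L)) = 1), one_smul] at key'
      rw [key']
      congr 1
      have hs : ∑ j ∈ (L.erase k)ᶜ, (j : ℕ) = k + ∑ j ∈ Lᶜ, (j : ℕ) := by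
        rw [← herase, Finset.add_sum_erase _ _ hkd]
      have hb := numBelow_add_numBelow_compl_erase k L
      have hch : (m + 1).choose 2 = m + m.choose 2 := by
        rw [Nat.choose_succ_succ' m 1, Nat.choose_one_right]
      rw [hs, hch, hcard]
      have : numBelow k (L.erase k)ᶜ + m + numBelow i L +
          (k + ∑ j ∈ Lᶜ, (j : ℕ) + m.choose 2 + (numBelow k L + numBelow i L)) =
          ∑ j ∈ Lᶜ, (j : ℕ) + (m + m.choose 2) + 2 * (k + numBelow i L) := by omega
      rw [this, pow_add, pow_mul (-1 : ℂ) 2]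
      simp

theorem sign_choose_two (k : ℕ) :
    (if (k + 1) % 4 = 2 then -1 else 1 : ℂ) * (if k % 4 = 2 then -1 else 1) =
      (-1 : ℂ) ^ ((k + 1).choose 2) := by
  induction k using Nat.strong_induction_on with
  | _ k ih =>
    by_cases hk : k < 4
    · interval_cases k <;> norm_num [Nat.choose]
    · obtain ⟨l, rfl⟩ := Nat.exists_eq_add_of_le' (not_lt.1 hk)
      have h := ih l (by omega)
      have hc : (l + 4 + 1).choose 2 = (l + 1).choose 2 + 2 * (2 * l + 5) := by
        simp only [Nat.choose_succ_succ' _ 1, Nat.choose_one_right]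
        omega
      rw [hc, pow_add, pow_mul, ← h, show l + 4 + 1 = l + 1 + 4 by ring, Nat.add_mod_right,
        Nat.add_mod_right]
      simp

theorem sgn4_mul_sgn4_erase {n : ℕ} {I : Finset (Fin n)} {i : Fin n} (hi : i ∈ I) :
    sgn4 I * sgn4 (I.erase i) = (-1 : ℂ) ^ (I.card.choose 2) := by
  have h := Finset.card_erase_add_one hi
  rw [← h, ← sign_choose_two, h]
  rfl

theorem eq_of_weight_eq {n : ℕ} {I K Kd : Finset (Fin n)} {i : Fin n} (hi : i ∈ I)
    (hK : K.card + Kd.card = n + 1)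
    (h : ∀ k : Fin n, ((if k ∈ K then 4 else 1) * (if k ∈ Kd then 1 / 4 else 1) : ℂ) =
      (if k ∈ I then 2 else 1 / 2) * (if k ∈ I.erase i then 2 else 1 / 2)) :
    K = I ∧ Kd = (I.erase i)ᶜ := by
  have hw : ∀ k, k ≠ i → ((k ∈ K ↔ k ∈ I) ∧ (k ∈ Kd ↔ k ∉ I)) := by
    intro k hk
    have := h k
    simp only [Finset.mem_erase, hk, ne_eq, not_false_eq_true, true_and] at this
    split_ifs at this <;> first | tauto | (norm_num at this)
  have hii : i ∈ K ↔ i ∈ Kd := by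
    have := h i
    simp only [Finset.mem_erase, ne_eq, not_true_eq_false, false_and, if_false, if_pos hi] at this
    split_ifs at this <;> first | tauto | (norm_num at this)
  have hiK : i ∈ K := by
    by_contra h0
    have hd : Disjoint K Kd := Finset.disjoint_left.2 fun k hk hk' => by
      have hne : k ≠ i := fun e => h0 (e ▸ hk)
      exact (hw k hne).2.1 hk' ((hw k hne).1.1 hk)
    have := Finset.card_le_univ (K ∪ Kd)
    rw [Finset.card_union_of_disjoint hd, Fintype.card_fin] at this
    omega
  refine ⟨Finset.ext fun k => ?_, Finset.ext fun k => ?_⟩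
  · by_cases hk : k = i
    · subst hk
      simp [hiK, hi]
    · exact (hw k hk).1
  · by_cases hk : k = i
    · subst hk
      simp [hii.1 hiK]
    · simp [(hw k hk).2, hk]

theorem eq_compl_erase_of_card {n : ℕ} {I Id : Finset (Fin n)}
    (h : I.card + Id.card = n + 1) (h1 : (I ∩ Id).card = 1) :
    ∃ i ∈ I, Id = (I.erase i)ᶜ := by
  obtain ⟨i, hi⟩ := Finset.card_eq_one.1 h1
  have hmem : i ∈ I ∩ Id := hi ▸ Finset.mem_singleton_self i
  have hun : I ∪ Id = Finset.univ := by
    rw [← Finset.card_eq_iff_eq_univ, Fintype.card_fin]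
    have := Finset.card_union_add_card_inter I Id
    omega
  refine ⟨i, (Finset.mem_inter.1 hmem).1, Finset.ext fun k => ?_⟩
  have hk1 : k ∈ I ∧ k ∈ Id ↔ k = i := by
    rw [← Finset.mem_inter, hi, Finset.mem_singleton]
  have hk2 : k ∈ I ∨ k ∈ Id := by
    rw [← Finset.mem_union, hun]
    exact Finset.mem_univ k
  simp only [Finset.mem_compl, Finset.mem_erase]
  tauto

theorem plucker_equals_product_of_cartan (n : ℕ) (hn : 0 < n)
    (p : ↥(⋀[ℂ]^(n + 1) (V n)) →ₗ[ℂ] (TensorProduct ℂ (SS n) (SS n)))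
    -- `p` takes values in `S₊ ⊗ S₋`:
    (hrange : ∀ ω, p ω ∈ LinearMap.range (TensorProduct.map
      (CliffordAlgebra.evenOdd (0 : QuadraticForm ℂ (Fin n → ℂ)) 0).subtype
      (CliffordAlgebra.evenOdd (0 : QuadraticForm ℂ (Fin n → ℂ)) 1).subtype))
    -- `p` is `Spin(Q)`-equivariant, where `g ∈ Spin(Q)` acts on `Λ^{n+1}ℂ^{2n}` via the
    -- `(n+1)`-st exterior power of `ρ(g)` and on `S₊ ⊗ S₋` via `Γ ⊗ Γ`:
    (hequiv : ∀ g : Cl n, SpinG g → ∀ T : V n →ₗ[ℂ] V n,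
      (∀ x : V n, CliffordAlgebra.ι (Qq n) (T x) =
        CliffordAlgebra.involute g * CliffordAlgebra.ι (Qq n) x * conjC g) →
      ∀ hT : ∀ y ∈ ⋀[ℂ]^(n + 1) (V n),
        ExteriorAlgebra.map T y ∈ ⋀[ℂ]^(n + 1) (V n),
      ∀ ω : ↥(⋀[ℂ]^(n + 1) (V n)),
        p ((ExteriorAlgebra.map T).toLinearMap.restrict hT ω) =
          TensorProduct.map (Gamma n g) (Gamma n g) (p ω))
    -- the normalization `p(e_{{1},[n]}) = (−1)^{n(n−1)/2} (1 ⊗ e₁)`: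
    (hnorm : p (eII {⟨0, hn⟩} Finset.univ) =
      ((-1 : ℂ) ^ (n * (n - 1) / 2)) •
        ((1 : SS n) ⊗ₜ[ℂ] ExteriorAlgebra.ι ℂ (Pi.single (⟨0, hn⟩ : Fin n) 1)))
    -- a decomposable value `p(v) = s₊ ⊗ s₋` with `s₊ ∈ S₊`, `s₋ ∈ S₋`:
    (v : ↥(⋀[ℂ]^(n + 1) (V n))) (sp sm : SS n)
    (hsp : sp ∈ CliffordAlgebra.evenOdd (0 : QuadraticForm ℂ (Fin n → ℂ)) 0)
    (hsm : sm ∈ CliffordAlgebra.evenOdd (0 : QuadraticForm ℂ (Fin n → ℂ)) 1)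
    (hpv : p v = sp ⊗ₜ[ℂ] sm)
    -- the Cartan coordinates: `Σ_J` is the coefficient of `σ(J) e_J` in `s₊` for `#J`
    -- even and in `s₋` for `#J` odd:
    (c : Finset (Fin n) → ℂ)
    (hcp : sp = ∑ J ∈ Finset.univ.filter (fun J : Finset (Fin n) => Even J.card),
      c J • (sgn4 J • eS J))
    (hcm : sm = ∑ J ∈ Finset.univ.filter (fun J : Finset (Fin n) => Odd J.card),
      c J • (sgn4 J • eS J))
    -- the Plücker coordinates: `Δ_{K,K^∨}` is the coefficient of `e_{K,K^∨}` in `v`: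
    (dc : Finset (Fin n) × Finset (Fin n) → ℂ)
    (hdc : v = ∑ P ∈ Finset.univ.filter
        (fun P : Finset (Fin n) × Finset (Fin n) => P.1.card + P.2.card = n + 1),
      dc P • eII P.1 P.2) :
    ∀ (I Id : Finset (Fin n)),
      I.card + Id.card = n + 1 → (I ∩ Id).card = 1 →
      ((-1 : ℂ) ^ (∑ j ∈ Id, (j : ℕ))) * dc (I, Id) = c I * c Idᶜ := by
  intro I Id hcard hinter
  obtain ⟨i, hi, rfl⟩ := eq_compl_erase_of_card hcard hinter
  have hp : IsSpinEquivariant p := hequiv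
  have hpI := hp.apply_eII hn hnorm hi
  have hodd : Odd (I.erase i).card ↔ Even I.card := by
    rw [← Finset.card_erase_add_one hi, Nat.even_add_one, Nat.not_even_iff_odd]
  have hsgn := sgn4_mul_sgn4_erase hi
  have hsq : ∀ k : ℕ, ((-1 : ℂ) ^ k) * (-1) ^ k = 1 := fun k => by rw [← mul_pow]; simp
  have hcoeff : ∀ J J' : Finset (Fin n),
      (∀ k : Fin n, ((if k ∈ J then 2 else 1 / 2) * (if k ∈ J' then 2 else 1 / 2) : ℂ) =
        (if k ∈ I then 2 else 1 / 2) * (if k ∈ I.erase i then 2 else 1 / 2)) →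
      cartanTensor I i = eS J ⊗ₜ[ℂ] eS J' →
      eSCoeff J sp * eSCoeff J' sm = dc (I, (I.erase i)ᶜ) *
        (-1 : ℂ) ^ ((∑ j ∈ (I.erase i)ᶜ, (j : ℕ)) + I.card.choose 2) := by
    intro J J' hw hB
    have h1 : LinearMap.mul' ℂ ℂ (TensorProduct.map (eSCoeff J) (eSCoeff J') (p v)) =
        eSCoeff J sp * eSCoeff J' sm := by
      rw [hpv, TensorProduct.map_tmul, LinearMap.mul'_apply]
    rw [← h1, hdc, map_sum, map_sum, map_sum,
      Finset.sum_eq_single_of_mem (I, (I.erase i)ᶜ) (by simpa using hcard)]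
    · rw [map_smul, hpI, hB, map_smul, map_smul, map_smul, map_smul, TensorProduct.map_tmul,
        LinearMap.mul'_apply, eSCoeff_eS_self, eSCoeff_eS_self]
      simp
    · rintro ⟨K, Kd⟩ hK hne
      have hK' : K.card + Kd.card = n + 1 := by simpa using hK
      rw [map_smul, map_smul, map_smul, smul_eq_mul, mul_eq_zero]
      right
      by_contra h0
      obtain ⟨rfl, rfl⟩ := eq_of_weight_eq hi hK' fun k =>
        ((hp.eSCoeff_eq_zero_or_weight hK' J J' k).resolve_left h0).trans (hw k)
      exact hne rfl
  rw [compl_compl]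
  by_cases he : Even I.card
  · have h := hcoeff I (I.erase i) (fun _ => rfl) (if_pos he)
    rw [hcp, hcm, eSCoeff_sum _ _ (by simpa using he),
      eSCoeff_sum _ _ (by simpa using hodd.2 he), pow_add, ← hsgn] at h
    have hs := hsq (I.card.choose 2)
    rw [← hsgn] at hs
    linear_combination (-(sgn4 I * sgn4 (I.erase i))) * h +
      (c I * c (I.erase i) - (-1) ^ (∑ j ∈ (I.erase i)ᶜ, (j : ℕ)) * dc (I, (I.erase i)ᶜ)) * hs
  · have h := hcoeff (I.erase i) I (fun _ => mul_comm _ _) (if_neg he)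
    rw [hcp, hcm, eSCoeff_sum _ _ (by simpa using Nat.not_odd_iff_even.1 (mt hodd.1 he)),
      eSCoeff_sum _ _ (by simpa using he), pow_add, ← hsgn] at h
    have hs := hsq (I.card.choose 2)
    rw [← hsgn] at hs
    linear_combination (-(sgn4 I * sgn4 (I.erase i))) * h +
      (c I * c (I.erase i) - (-1) ^ (∑ j ∈ (I.erase i)ᶜ, (j : ℕ)) * dc (I, (I.erase i)ᶜ)) * hs
end
end

section
/- Let M be a skew-symmetric n×n complex matrix, let g := exp(−Σ_{1≤i<j≤n} M_{ij} e_i e_j) ∈ Cl(Q), and let w := e_1 − e_1^∨. Then for every J ⊆ [n] with #J odd, the coefficient of σ(J) e_J in Γ_w(Γ_g(1)) equals (−1)^{(#J−1)/2} pf(M_{JΔ{1}}^{JΔ{1}}), where JΔ{1} denotes the symmetric difference (J∖{1} if 1 ∈ J, J∪{1} if 1 ∉ J). -/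
open scoped TensorProduct

noncomputable section

open Matrix

/-- The Pfaffian of a skew-symmetric `N × N` complex matrix:
`pf(A) = (1/(2^m m!)) Σ_{σ ∈ S_N} sgn(σ) Π_{i=1}^{m} A_{σ(2i−1) σ(2i)}` where `N = 2m`;
it is `0` when `N` is odd (and `1` for the empty matrix). -/
def pfaff {N : ℕ} (A : Matrix (Fin N) (Fin N) ℂ) : ℂ :=
  if h : N % 2 = 0 then
    ((2 : ℂ) ^ (N / 2) * ((N / 2).factorial : ℂ))⁻¹ *
      ∑ σ : Equiv.Perm (Fin N),
        ((Equiv.Perm.sign σ : ℤ) : ℂ) *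
          ∏ i : Fin (N / 2),
            A (σ ⟨2 * i, by have := i.isLt; omega⟩) (σ ⟨2 * i + 1, by have := i.isLt; omega⟩)
  else 0

/-- The Pfaffian of the principal submatrix `A_I^I` of `A`, with rows and columns
indexed by `I` in increasing order. -/
def pfaffSub {N : ℕ} (A : Matrix (Fin N) (Fin N) ℂ) (I : Finset (Fin N)) : ℂ :=
  pfaff (Matrix.of fun a b : Fin I.card =>
    A ((I.orderIsoOfFin rfl a : I) : Fin N) ((I.orderIsoOfFin rfl b : I) : Fin N))

theorem eS_eq_ιMulti {n k : ℕ} (J : Finset (Fin n)) (h : J.card = k) :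
    eS J = ExteriorAlgebra.ιMulti ℂ k fun i => Pi.single (J.orderEmbOfFin h i) 1 := by
  rw [ExteriorAlgebra.ιMulti_apply, eS, ← Finset.listMap_orderEmbOfFin_finRange J h, List.map_map,
    List.ofFn_eq_map]
  rfl

theorem linearIndependent_eS (n : ℕ) :
    LinearIndependent ℂ (eS : Finset (Fin n) → SS n) := by
  have h : (eS : Finset (Fin n) → SS n) = (Pi.basisFun ℂ (Fin n)).ExteriorAlgebra := by
    funext J
    rw [ExteriorAlgebra.basis_apply, eS_eq_ιMulti J rfl]
    congr 1
    funext i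
    simp only [Function.comp_apply, Pi.basisFun_apply]
    rfl
  rw [h]
  exact Module.Basis.linearIndependent _

theorem pfaff_two_mul {m : ℕ} (A : Matrix (Fin (2 * m)) (Fin (2 * m)) ℂ) :
    pfaff A = ((2 : ℂ) ^ m * (m.factorial : ℂ))⁻¹ *
      ∑ σ : Equiv.Perm (Fin (2 * m)), ((Equiv.Perm.sign σ : ℤ) : ℂ) *
        ∏ i : Fin m, A (σ ⟨2 * i, by omega⟩) (σ ⟨2 * i + 1, by omega⟩) := by
  have hm : 2 * m / 2 = m := by omega
  rw [pfaff, dif_pos (by omega)]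
  congr 1
  · rw [hm]
  refine Finset.sum_congr rfl fun σ _ => ?_
  congr 1
  exact Fintype.prod_equiv (finCongr hm) _ _ fun _ => rfl

theorem pfaffSub_eq_pfaff {n k : ℕ} (A : Matrix (Fin n) (Fin n) ℂ) (I : Finset (Fin n))
    (h : I.card = k) :
    pfaffSub A I =
      pfaff (Matrix.of fun a b : Fin k => A (I.orderEmbOfFin h a) (I.orderEmbOfFin h b)) := by
  subst h
  rfl

theorem pfaffSub_of_odd {n : ℕ} (A : Matrix (Fin n) (Fin n) ℂ) (I : Finset (Fin n))
    (h : Odd I.card) : pfaffSub A I = 0 := by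
  rw [pfaffSub, pfaff, dif_neg]
  rcases h with ⟨k, hk⟩
  omega

/-- The element `∑ i j, M i j e_i ∧ e_j` of the exterior algebra. -/
def wedgeSum {n : ℕ} (M : Matrix (Fin n) (Fin n) ℂ) : SS n :=
  ∑ i, ∑ j, M i j • (ExteriorAlgebra.ι ℂ (Pi.single i 1) * ExteriorAlgebra.ι ℂ (Pi.single j 1))

theorem wedgeSum_pow {n : ℕ} (M : Matrix (Fin n) (Fin n) ℂ) (m : ℕ) :
    wedgeSum M ^ m = ∑ f : Fin (2 * m) → Fin n,
      (∏ i : Fin m, M (f ⟨2 * i, by omega⟩) (f ⟨2 * i + 1, by omega⟩)) •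
        ExteriorAlgebra.ιMulti ℂ (2 * m) fun i => Pi.single (f i) (1 : ℂ) := by
  induction m with
  | zero => simp
  | succ m ih =>
    rw [pow_succ', ih]
    change _ = ∑ f : Fin (2 * m + 1 + 1) → Fin n, _
    rw [← (Fin.consEquiv fun _ : Fin (2 * m + 1 + 1) => Fin n).sum_comp, Fintype.sum_prod_type,
      wedgeSum, Finset.sum_mul]
    refine Finset.sum_congr rfl fun a _ => ?_
    rw [← (Fin.consEquiv fun _ : Fin (2 * m + 1) => Fin n).sum_comp, Fintype.sum_prod_type,
      Finset.sum_mul]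
    refine Finset.sum_congr rfl fun b _ => ?_
    rw [Finset.mul_sum]
    refine Finset.sum_congr rfl fun f _ => ?_
    rw [smul_mul_smul_comm, Fin.prod_univ_succ]
    congr 1
    rw [mul_assoc]
    symm
    erw [ExteriorAlgebra.ιMulti_succ_apply, ExteriorAlgebra.ιMulti_succ_apply]
    rfl

theorem sum_image_eq_sum_perm {n k : ℕ} {A : Type*} [AddCommMonoid A] (F : (Fin k → Fin n) → A)
    (I : Finset (Fin n)) (h : I.card = k) :
    ∑ f with Finset.univ.image f = I, F f =
      ∑ σ : Equiv.Perm (Fin k), F (I.orderEmbOfFin h ∘ σ) := by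
  symm
  refine Finset.sum_bij (fun σ _ => I.orderEmbOfFin h ∘ σ) ?_ ?_ ?_ fun _ _ => rfl
  · intro σ _
    rw [Finset.mem_filter, ← Finset.image_image, Finset.image_univ_equiv,
      Finset.image_orderEmbOfFin_univ]
    exact ⟨Finset.mem_univ _, rfl⟩
  · intro σ _ τ _ hστ
    ext i
    exact congrArg Fin.val ((I.orderEmbOfFin h).injective (congrFun hστ i))
  · intro f hf
    obtain ⟨-, hf⟩ := Finset.mem_filter.1 hf
    have hinj : Function.Injective f := by
      rw [← Set.injOn_univ, ← Finset.coe_univ, ← Finset.card_image_iff, hf, h, Finset.card_fin]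
    have hmem : ∀ i, f i ∈ I := fun i => hf ▸ Finset.mem_image_of_mem f (Finset.mem_univ i)
    have hbij : Function.Bijective fun i => (I.orderIsoOfFin h).symm ⟨f i, hmem i⟩ := by
      refine Finite.injective_iff_bijective.1 fun i j hij => hinj ?_
      exact congrArg Subtype.val ((I.orderIsoOfFin h).symm.injective hij)
    refine ⟨Equiv.ofBijective _ hbij, Finset.mem_univ _, ?_⟩
    funext i
    simp [← Finset.coe_orderIsoOfFin_apply]

theorem wedgeSum_pow_eq_pfaffSub {n : ℕ} (M : Matrix (Fin n) (Fin n) ℂ) (m : ℕ) :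
    wedgeSum M ^ m = ∑ I : Finset (Fin n),
      if I.card = 2 * m then ((2 : ℂ) ^ m * (m.factorial : ℂ) * pfaffSub M I) • eS I else 0 := by
  rw [wedgeSum_pow, ← Finset.sum_fiberwise _ (fun f => Finset.univ.image f)]
  refine Finset.sum_congr rfl fun I _ => ?_
  split_ifs with h
  · rw [sum_image_eq_sum_perm _ I h, pfaffSub_eq_pfaff M I h, pfaff_two_mul, mul_inv_cancel_left₀,
      Finset.sum_smul]
    · refine Finset.sum_congr rfl fun σ _ => ?_
      have hperm := (ExteriorAlgebra.ιMulti ℂ (M := Fin n → ℂ) (2 * m)).map_perm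
        (fun i => Pi.single (I.orderEmbOfFin h i) 1) σ
      rw [← eS_eq_ιMulti I h] at hperm
      simp only [Function.comp_def] at hperm ⊢
      rw [hperm, mul_smul, smul_comm, Int.cast_smul_eq_zsmul]
      rfl
    · exact mul_ne_zero (pow_ne_zero _ two_ne_zero) (Nat.cast_ne_zero.2 m.factorial_ne_zero)
  · refine Finset.sum_eq_zero fun f hf => ?_
    rw [ExteriorAlgebra.ιMulti_eq_zero_of_not_inj, smul_zero]
    intro hinj
    apply h
    rw [← (Finset.mem_filter.1 hf).2, Finset.card_image_of_injective _
      (Function.Injective.of_comp (f := fun a : Fin n => (Pi.single a 1 : Fin n → ℂ)) hinj),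
      Finset.card_fin]

theorem wedgeSum_eq_two_smul {n : ℕ} (M : Matrix (Fin n) (Fin n) ℂ) (hM : Mᵀ = -M) :
    wedgeSum M = (2 : ℂ) • ∑ p ∈ Finset.univ.filter (fun p : Fin n × Fin n => p.1 < p.2),
      M p.1 p.2 •
        (ExteriorAlgebra.ι ℂ (Pi.single p.1 1) * ExteriorAlgebra.ι ℂ (Pi.single p.2 1)) := by
  set G : Fin n × Fin n → SS n := fun p => M p.1 p.2 •
    (ExteriorAlgebra.ι ℂ (Pi.single p.1 1) * ExteriorAlgebra.ι ℂ (Pi.single p.2 1)) with hG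
  have hswap : ∀ p, G p.swap = G p := by
    intro p
    have h1 : M p.2 p.1 = -M p.1 p.2 := congrFun (congrFun hM p.1) p.2
    have h2 := eq_neg_of_add_eq_zero_left
      (ExteriorAlgebra.ι_add_mul_swap (R := ℂ) (Pi.single p.2 1 : Fin n → ℂ) (Pi.single p.1 1))
    simp only [hG, Prod.fst_swap, Prod.snd_swap]
    rw [h1, h2, neg_smul, smul_neg, neg_neg]
  have hdiag : ∀ p : Fin n × Fin n, p.1 = p.2 → G p = 0 := by
    intro p hp
    simp only [hG]
    rw [hp, ExteriorAlgebra.ι_sq_zero, smul_zero]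
  have hsum : wedgeSum M = ∑ p, G p := (Fintype.sum_prod_type G).symm
  have hge : ∑ p with ¬ p.1 < p.2, G p = ∑ p with p.1 < p.2, G p := by
    rw [Finset.sum_filter, Finset.sum_filter, ← (Equiv.prodComm (Fin n) (Fin n)).sum_comp]
    refine Finset.sum_congr rfl fun p _ => ?_
    simp only [Equiv.prodComm_apply, Prod.fst_swap, Prod.snd_swap, hswap]
    rcases lt_trichotomy p.1 p.2 with h | h | h
    · rw [if_pos h, if_pos h.not_gt]
    · rw [hdiag p h, ite_self, ite_self]
    · rw [if_neg (not_not.2 h), if_neg h.not_gt]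
  rw [hsum, ← Finset.sum_filter_add_sum_filter_not _ (fun p : Fin n × Fin n => p.1 < p.2), hge,
    two_smul]

theorem Gamma_ι (n : ℕ) (v : V n) : Gamma n (CliffordAlgebra.ι (Qq n) v) = gamGen n v :=
  CliffordAlgebra.lift_ι_apply _ _ _

theorem Gamma_ι_eW (n : ℕ) (i : Fin n) :
    Gamma n (CliffordAlgebra.ι (Qq n) (eW n i)) =
      LinearMap.mulLeft ℂ (ExteriorAlgebra.ι ℂ (Pi.single i 1)) := by
  rw [Gamma_ι]
  ext x
  simp [gamGen, eW]

theorem Gamma_exp_one {n : ℕ} (M : Matrix (Fin n) (Fin n) ℂ) (hM : Mᵀ = -M) (ξ : Cl n)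
    (hξ : ξ = -∑ p ∈ Finset.univ.filter (fun p : Fin n × Fin n => p.1 < p.2),
      M p.1 p.2 •
        (CliffordAlgebra.ι (Qq n) (eW n p.1) * CliffordAlgebra.ι (Qq n) (eW n p.2)))
    {N : ℕ} (hN : n < 2 * N) :
    Gamma n (∑ k ∈ Finset.range N, ((k.factorial : ℂ))⁻¹ • ξ ^ k) 1 =
      ∑ I : Finset (Fin n), ((-1 : ℂ) ^ (I.card / 2) * pfaffSub M I) • eS I := by
  have hξ' : Gamma n ξ = LinearMap.mulLeft ℂ ((-(1 / 2) : ℂ) • wedgeSum M) := by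
    rw [wedgeSum_eq_two_smul M hM, smul_smul, hξ, map_neg, map_sum]
    ext x
    simp [Gamma_ι_eW, Finset.sum_mul, mul_assoc]
  have hterm : ∀ k : ℕ, Gamma n (((k.factorial : ℂ))⁻¹ • ξ ^ k) 1 =
      ∑ I : Finset (Fin n),
        if I.card = 2 * k then ((-1 : ℂ) ^ k * pfaffSub M I) • eS I else 0 := by
    intro k
    rw [map_smul, map_pow, hξ', LinearMap.pow_mulLeft, LinearMap.smul_apply,
      LinearMap.mulLeft_apply, mul_one, smul_pow, wedgeSum_pow_eq_pfaffSub, smul_smul,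
      Finset.smul_sum]
    refine Finset.sum_congr rfl fun I _ => ?_
    split_ifs
    · rw [smul_smul]
      congr 1
      have hk : (k.factorial : ℂ) ≠ 0 := Nat.cast_ne_zero.2 k.factorial_ne_zero
      have h2 : (-(1 / 2) : ℂ) ^ k * 2 ^ k = (-1) ^ k := by rw [← mul_pow]; norm_num
      rw [← h2]
      field_simp
    · rw [smul_zero]
  rw [map_sum, LinearMap.sum_apply, Finset.sum_congr rfl fun k _ => hterm k, Finset.sum_comm]
  refine Finset.sum_congr rfl fun I _ => ?_
  rcases Nat.even_or_odd' I.card with ⟨m, h | h⟩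
  · have hI : I.card ≤ n := by simpa using I.card_le_univ
    rw [Finset.sum_eq_single m, if_pos h, h, Nat.mul_div_cancel_left _ two_pos]
    · intro k _ hk
      rw [if_neg]
      omega
    · intro hm
      rw [Finset.mem_range] at hm
      omega
  · rw [pfaffSub_of_odd M I ⟨m, h⟩, mul_zero, zero_smul]
    refine Finset.sum_eq_zero fun k _ => ?_
    rw [if_neg]
    omega

/-- The symmetric difference of `J` with the singleton `{a}`. -/
def toggle {α : Type*} [DecidableEq α] (a : α) (J : Finset α) : Finset α :=
  if a ∈ J then J.erase a else insert a J

theorem mem_toggle_self {α : Type*} [DecidableEq α] (a : α) (J : Finset α) :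
    a ∈ toggle a J ↔ a ∉ J := by
  unfold toggle
  split_ifs with h <;> simp [h]

theorem toggle_involutive {α : Type*} [DecidableEq α] (a : α) :
    Function.Involutive (toggle a) := by
  intro J
  by_cases h : a ∈ J
  · rw [toggle, if_neg (by rw [mem_toggle_self]; exact not_not.2 h), toggle, if_pos h,
      Finset.insert_erase h]
  · rw [toggle, if_pos ((mem_toggle_self a J).2 h), toggle, if_neg h, Finset.erase_insert h]

theorem eS_insert_zero {n : ℕ} (hn : 0 < n) {J : Finset (Fin n)} (h : ⟨0, hn⟩ ∉ J) :
    eS (insert ⟨0, hn⟩ J) = ExteriorAlgebra.ι ℂ (Pi.single ⟨0, hn⟩ 1) * eS J := by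
  have hle : ∀ b ∈ J, (⟨0, hn⟩ : Fin n) ≤ b := fun b _ => Nat.zero_le b.1
  rw [eS, Finset.sort_insert (r := (· ≤ ·)) hle h, List.map_cons, List.prod_cons, eS]

theorem contractLeft_eS {n : ℕ} (i : Fin n) {J : Finset (Fin n)} (h : i ∉ J) :
    CliffordAlgebra.contractLeft (Q := (0 : QuadraticForm ℂ (Fin n → ℂ)))
      (dualL n (Pi.single i 1)) (eS J) = 0 := by
  have key : ∀ l : List (Fin n), i ∉ l →
      CliffordAlgebra.contractLeft (Q := (0 : QuadraticForm ℂ (Fin n → ℂ)))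
        (dualL n (Pi.single i 1))
        ((l.map fun j => ExteriorAlgebra.ι ℂ (Pi.single j (1 : ℂ))).prod) = 0 := by
    intro l
    induction l with
    | nil => exact fun _ => CliffordAlgebra.contractLeft_one _ _
    | cons a l ih =>
      intro hl
      rw [List.mem_cons, not_or] at hl
      rw [List.map_cons, List.prod_cons]
      refine (CliffordAlgebra.contractLeft_ι_mul _ _ _).trans ?_
      rw [ih hl.2, mul_zero, sub_zero]
      have : dualL n (Pi.single i 1) (Pi.single a 1) = 0 := by
        simp [dualL, Pi.single_apply, hl.1]
      rw [this, zero_smul]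
  exact key _ (by rwa [Finset.mem_sort])

theorem Gamma_reflection_eS {n : ℕ} (hn : 0 < n) (J : Finset (Fin n)) :
    Gamma n (CliffordAlgebra.ι (Qq n) (eW n ⟨0, hn⟩ - eD n ⟨0, hn⟩)) (eS J) =
      (if ⟨0, hn⟩ ∈ J then -1 else 1 : ℂ) • eS (toggle ⟨0, hn⟩ J) := by
  have hact : ∀ x : SS n, Gamma n (CliffordAlgebra.ι (Qq n) (eW n ⟨0, hn⟩ - eD n ⟨0, hn⟩)) x =
      ExteriorAlgebra.ι ℂ (Pi.single ⟨0, hn⟩ 1) * x -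
        CliffordAlgebra.contractLeft (Q := (0 : QuadraticForm ℂ (Fin n → ℂ)))
          (dualL n (Pi.single ⟨0, hn⟩ 1)) x := by
    intro x
    rw [map_sub, map_sub, Gamma_ι_eW, Gamma_ι, LinearMap.sub_apply]
    simp [gamGen, eD]
  rw [hact, toggle]
  split_ifs with h
  · obtain ⟨K, hK, rfl⟩ : ∃ K : Finset (Fin n), ⟨0, hn⟩ ∉ K ∧ insert ⟨0, hn⟩ K = J :=
      ⟨J.erase _, Finset.notMem_erase _ _, Finset.insert_erase h⟩
    rw [Finset.erase_insert hK, eS_insert_zero hn hK, ← mul_assoc, ExteriorAlgebra.ι_sq_zero,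
      zero_mul, zero_sub, neg_smul, one_smul, neg_inj]
    refine (CliffordAlgebra.contractLeft_ι_mul _ _ _).trans ?_
    rw [contractLeft_eS _ hK, mul_zero, sub_zero]
    have : dualL n (Pi.single ⟨0, hn⟩ 1) (Pi.single ⟨0, hn⟩ 1) = 1 := by
      simp [dualL, Pi.single_apply]
    rw [this, one_smul]
  · rw [contractLeft_eS _ h, sub_zero, one_smul, eS_insert_zero hn h]

theorem odd_coefficients_are_pfaffians (n : ℕ) (hn : 0 < n)
    (M : Matrix (Fin n) (Fin n) ℂ) (hM : Mᵀ = -M)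
    (ξ : Cl n)
    (hξ : ξ = -∑ p ∈ Finset.univ.filter (fun p : Fin n × Fin n => p.1 < p.2),
      M p.1 p.2 • (CliffordAlgebra.ι (Qq n) (eW n p.1) * CliffordAlgebra.ι (Qq n) (eW n p.2)))
    -- `g = exp(ξ)`, which here is the finite sum `Σ_{k ≤ 2n+1} ξ^k / k!` since `ξ` is
    -- nilpotent:
    (g : Cl n) (hg : g = ∑ k ∈ Finset.range (2 * n + 2), ((k.factorial : ℂ))⁻¹ • ξ ^ k)
    (w : V n) (hw : w = eW n ⟨0, hn⟩ - eD n ⟨0, hn⟩)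
    -- expand `Γ_w(Γ_g(1))` in the basis `{σ(J) e_J}` with coefficients `c J`:
    (c : Finset (Fin n) → ℂ)
    (hc : Gamma n (CliffordAlgebra.ι (Qq n) w) (Gamma n g 1) =
      ∑ J : Finset (Fin n), c J • (sgn4 J • eS J)) :
    ∀ J : Finset (Fin n), Odd J.card →
      c J = (-1 : ℂ) ^ ((J.card - 1) / 2) *
        pfaffSub M (if (⟨0, hn⟩ : Fin n) ∈ J then J.erase ⟨0, hn⟩ else insert ⟨0, hn⟩ J) := by
  intro J hJ
  subst hg hw
  rw [Gamma_exp_one M hM ξ hξ (by omega), map_sum] at hc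
  simp only [map_smul, Gamma_reflection_eS, smul_smul] at hc
  rw [← Equiv.sum_comp (toggle_involutive (⟨0, hn⟩ : Fin n)).toPerm] at hc
  simp only [Function.Involutive.coe_toPerm, toggle_involutive (⟨0, hn⟩ : Fin n) _,
    mem_toggle_self] at hc
  have hcJ := Fintype.linearIndependent_iffₛ.1 (linearIndependent_eS n) _ _ hc J
  have hJ4 : sgn4 J = 1 := by
    rw [sgn4, if_neg]
    rcases hJ with ⟨k, hk⟩
    omega
  rw [hJ4, mul_one] at hcJ
  rw [← hcJ]
  change _ = _ * pfaffSub M (toggle _ J)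
  obtain ⟨k, hk⟩ := hJ
  have hk' : (J.card - 1) / 2 = k := by omega
  rw [hk']
  by_cases h : (⟨0, hn⟩ : Fin n) ∈ J
  · have hcard : (toggle ⟨0, hn⟩ J).card = 2 * k := by
      rw [toggle, if_pos h, Finset.card_erase_of_mem h]
      omega
    rw [hcard, Nat.mul_div_cancel_left _ two_pos, if_neg (not_not.2 h), mul_one]
  · have hcard : (toggle ⟨0, hn⟩ J).card = 2 * (k + 1) := by
      rw [toggle, if_neg h, Finset.card_insert_of_notMem h]
      omega
    rw [hcard, Nat.mul_div_cancel_left _ two_pos, if_pos h, pow_succ]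
    ring
end
end
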